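/- arXiv:2504.07764 — 2 statements merged into one kernel-verified Lean document; each statement's English description precedes it below -/
import Mathlib

section
/- For every integer k ≥ 3, every finite set X, and every set C of k-colorings of X, there exists a graph G with X ⊆ V(G) that is X-rooted-K_{k+1}-minor-free and K_{k+2}-minor-free and realizes C: a function f : X → [k] extends to a proper k-coloring of G if and only if f ∈ C. -/
/-- `c` is a proper `k`-coloring of `G` with colors in `[k] = {1,…,k}`. -/
def IsProperKColoring {V : Type*} (G : SimpleGraph V) (k : ℕ) (c : V → ℕ) : Prop :=
  (∀ v, c v ∈ Finset.Icc 1 k) ∧ ∀ ⦃x y⦄, G.Adj x y → c x ≠ c y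

/-- `G` has a `K_m` minor, expressed via a minor model. -/
def HasCliqueMinor {V : Type*} (G : SimpleGraph V) (m : ℕ) : Prop :=
  ∃ μ : Fin m → Set V,
    (∀ i, (μ i).Nonempty ∧ (G.induce (μ i)).Connected) ∧
    (∀ i j, i ≠ j → Disjoint (μ i) (μ j)) ∧
    (∀ i j, i ≠ j → ∃ a ∈ μ i, ∃ b ∈ μ j, G.Adj a b)

/-- `G` has an `X`-rooted `K_m` minor: a minor model of `K_m` each of whose
branch sets meets `X`. -/
def HasRootedCliqueMinor {V : Type*} (G : SimpleGraph V) (X : Set V) (m : ℕ) : Prop :=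
  ∃ μ : Fin m → Set V,
    (∀ i, (μ i ∩ X).Nonempty ∧ (G.induce (μ i)).Connected) ∧
    (∀ i j, i ≠ j → Disjoint (μ i) (μ j)) ∧
    (∀ i j, i ≠ j → ∃ a ∈ μ i, ∃ b ∈ μ j, G.Adj a b)


/-- Mod-2 boundary of a chain of edges. -/
def bdry {V E : Type} [Fintype E] [DecidableEq V] (src tgt : E → V) (z : E → ZMod 2) (v : V) : ZMod 2 :=
  ∑ e, z e * ((if src e = v then 1 else 0) + (if tgt e = v then 1 else 0))

/-- Algebraic duality: the cycles are exactly the cuts of the dual. -/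
def Dual {V E F : Type} [Fintype E] [DecidableEq V] (src tgt : E → V) (l r : E → F) : Prop :=
  ∀ z : E → ZMod 2, (∀ v, bdry src tgt z v = 0) ↔
    ∃ S : F → ZMod 2, ∀ e, z e = S (l e) + S (r e)

/-- the edge `e` joins `x` and `y` -/
def Joins {V E : Type} (src tgt : E → V) (e : E) (x y : V) : Prop :=
  (src e = x ∧ tgt e = y) ∨ (src e = y ∧ tgt e = x)

theorem bdry_add {V E : Type} [Fintype E] [DecidableEq V] (src tgt : E → V) (z w : E → ZMod 2) (v : V) :
    bdry src tgt (z + w) v = bdry src tgt z v + bdry src tgt w v := by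
  simp [bdry, add_mul, Finset.sum_add_distrib]

theorem bdry_smul {V E : Type} [Fintype E] [DecidableEq V] (src tgt : E → V) (a : ZMod 2) (z : E → ZMod 2) (v : V) :
    bdry src tgt (a • z) v = a * bdry src tgt z v := by
  simp [bdry, Finset.mul_sum, mul_assoc]

theorem bdry_sum {V E : Type} [Fintype E] [DecidableEq V] (src tgt : E → V) {I : Type} (s : Finset I)
    (z : I → E → ZMod 2) (v : V) :
    bdry src tgt (∑ i ∈ s, z i) v = ∑ i ∈ s, bdry src tgt (z i) v := by
  simp only [bdry, Finset.sum_apply, Finset.sum_mul]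
  rw [Finset.sum_comm]

theorem bdry_single {V E : Type} [Fintype E] [DecidableEq E] [DecidableEq V] (src tgt : E → V) (e : E) (v : V) :
    bdry src tgt (Pi.single e 1) v = (if src e = v then 1 else 0) + (if tgt e = v then 1 else 0) := by
  simp [bdry, Pi.single_apply]

theorem bdry_joins {V E : Type} [Fintype E] [DecidableEq E] [DecidableEq V] (src tgt : E → V) (e : E) (x y v : V)
    (h : Joins src tgt e x y) :
    bdry src tgt (Pi.single e 1) v = (if x = v then 1 else 0) + (if y = v then 1 else 0) := by
  rw [bdry_single]
  rcases h with ⟨h1, h2⟩ | ⟨h1, h2⟩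
  · rw [h1, h2]
  · rw [h1, h2, add_comm]

theorem zmod2_cancel (a : ZMod 2) : a + a = 0 := CharTwo.add_self_eq_zero a

/-- path vectors inside a connected set -/
theorem path_vec {V E : Type} [Fintype E] [DecidableEq V] (src tgt : E → V)
    (G : SimpleGraph V) (hG : ∀ x y, G.Adj x y → ∃ e, Joins src tgt e x y)
    (B : Set V) (hB : (G.induce B).Connected) (x y : V) (hx : x ∈ B) (hy : y ∈ B) :
    ∃ z : E → ZMod 2, (∀ e, z e ≠ 0 → src e ∈ B ∧ tgt e ∈ B) ∧
      ∀ v, bdry src tgt z v = (if x = v then 1 else 0) + (if y = v then 1 else 0) := by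
  classical
  obtain ⟨w⟩ := hB.preconnected ⟨x, hx⟩ ⟨y, hy⟩
  have key : ∀ (a b : B) (w : (G.induce B).Walk a b), ∃ z : E → ZMod 2,
      (∀ e, z e ≠ 0 → src e ∈ B ∧ tgt e ∈ B) ∧
      ∀ v, bdry src tgt z v = (if a.1 = v then 1 else 0) + (if b.1 = v then 1 else 0) := by
    intro a b w
    induction w with
    | nil => exact ⟨0, by simp, fun v => by rw [zmod2_cancel]; simp [bdry]⟩
    | @cons a b c h w ih =>
      obtain ⟨z, hz1, hz2⟩ := ih
      obtain ⟨e, he⟩ := hG a.1 b.1 h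
      refine ⟨Pi.single e 1 + z, ?_, ?_⟩
      · intro e' he'
        by_cases h' : e' = e
        · subst h'
          rcases he with ⟨h1, h2⟩ | ⟨h1, h2⟩ <;> rw [h1, h2] <;> exact ⟨Subtype.prop _, Subtype.prop _⟩
        · apply hz1
          simpa [Pi.single_apply, h'] using he'
      · intro v
        rw [bdry_add, hz2, bdry_joins src tgt e _ _ v he]
        have := zmod2_cancel (if b.1 = v then 1 else 0)
        linear_combination this
  exact key _ _ w

/-- Edges of `K_5`. -/
abbrev P5 : Type := {p : Fin 5 × Fin 5 // p.1 < p.2}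

/-- degree parity of an edge set of `K_5` -/
def deg5 (y : P5 → ZMod 2) (i : Fin 5) : ZMod 2 :=
  ∑ p : P5, y p * ((if p.1.1 = i then 1 else 0) + (if p.1.2 = i then 1 else 0))

def pr (i j : Fin 5) (h : i < j) : P5 := ⟨(i, j), h⟩

theorem sum_P5 {M : Type*} [AddCommMonoid M] (f : P5 → M) : ∑ p, f p =
    f (pr 0 1 (by decide)) + (f (pr 0 2 (by decide)) + (f (pr 0 3 (by decide)) + (f (pr 0 4 (by decide)) +
    (f (pr 1 2 (by decide)) + (f (pr 1 3 (by decide)) + (f (pr 1 4 (by decide)) + (f (pr 2 3 (by decide)) +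
    (f (pr 2 4 (by decide)) + f (pr 3 4 (by decide)))))))))) := by
  have : (Finset.univ : Finset P5) = {pr 0 1 (by decide), pr 0 2 (by decide), pr 0 3 (by decide),
    pr 0 4 (by decide), pr 1 2 (by decide), pr 1 3 (by decide), pr 1 4 (by decide), pr 2 3 (by decide),
    pr 2 4 (by decide), pr 3 4 (by decide)} := by decide
  rw [this]
  repeat rw [Finset.sum_insert (by decide)]
  rw [Finset.sum_singleton]

set_option synthInstance.maxSize 1000 in
theorem deg5_support_aux : ∀ a b c d : ZMod 2, a + b + c + d = 0 → ∀ e f g : ZMod 2, a + e + f + g = 0 →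
    ∀ h i : ZMod 2, b + e + h + i = 0 → ∀ j : ZMod 2, c + f + h + j = 0 → d + g + i + j = 0 →
    ((a.val + (b.val + (c.val + (d.val + (e.val + (f.val + (g.val + (h.val + (i.val + j.val)))))))) = 0) ∨
    3 ≤ a.val + (b.val + (c.val + (d.val + (e.val + (f.val + (g.val + (h.val + (i.val + j.val))))))))) := by
  decide

theorem deg5_expand (y : P5 → ZMod 2) (h : ∀ i, deg5 y i = 0) :
    y (pr 0 1 (by decide)) + y (pr 0 2 (by decide)) + y (pr 0 3 (by decide)) + y (pr 0 4 (by decide)) = 0 ∧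
    y (pr 0 1 (by decide)) + y (pr 1 2 (by decide)) + y (pr 1 3 (by decide)) + y (pr 1 4 (by decide)) = 0 ∧
    y (pr 0 2 (by decide)) + y (pr 1 2 (by decide)) + y (pr 2 3 (by decide)) + y (pr 2 4 (by decide)) = 0 ∧
    y (pr 0 3 (by decide)) + y (pr 1 3 (by decide)) + y (pr 2 3 (by decide)) + y (pr 3 4 (by decide)) = 0 ∧
    y (pr 0 4 (by decide)) + y (pr 1 4 (by decide)) + y (pr 2 4 (by decide)) + y (pr 3 4 (by decide)) = 0 := by
  refine ⟨?_, ?_, ?_, ?_, ?_⟩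
  · have := h 0; rw [deg5, sum_P5] at this; simp [pr] at this; simp [pr]; linear_combination this
  · have := h 1; rw [deg5, sum_P5] at this; simp [pr] at this; simp [pr]; linear_combination this
  · have := h 2; rw [deg5, sum_P5] at this; simp [pr] at this; simp [pr]; linear_combination this
  · have := h 3; rw [deg5, sum_P5] at this; simp [pr] at this; simp [pr]; linear_combination this
  · have := h 4; rw [deg5, sum_P5] at this; simp [pr] at this; simp [pr]; linear_combination this

theorem deg5_support (y : P5 → ZMod 2) (h : ∀ i, deg5 y i = 0) (hy : y ≠ 0) :
    3 ≤ ∑ p, (y p).val := by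
  obtain ⟨h0, h1, h2, h3, h4⟩ := deg5_expand y h
  rw [sum_P5]
  rcases deg5_support_aux _ _ _ _ h0 _ _ _ h1 _ _ h2 _ h3 h4 with h' | h'
  · exfalso
    apply hy
    rw [← sum_P5 (fun p => (y p).val)] at h'
    funext p
    have := (Finset.sum_eq_zero_iff.1 h') p (Finset.mem_univ _)
    exact (ZMod.val_eq_zero _).1 this
  · exact h'

def cyc5 (x : Fin 6 → ZMod 2) : P5 → ZMod 2 := fun p =>
  if p.1 = (1, 2) then x 0 else if p.1 = (1, 3) then x 1 else if p.1 = (1, 4) then x 2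
  else if p.1 = (2, 3) then x 3 else if p.1 = (2, 4) then x 4 else if p.1 = (3, 4) then x 5
  else if p.1 = (0, 1) then x 0 + x 1 + x 2 else if p.1 = (0, 2) then x 0 + x 3 + x 4
  else if p.1 = (0, 3) then x 1 + x 3 + x 5 else x 2 + x 4 + x 5

theorem cyc5_cyc (x : Fin 6 → ZMod 2) (i : Fin 5) : deg5 (cyc5 x) i = 0 := by
  have h0 := zmod2_cancel (x 0)
  have h1 := zmod2_cancel (x 1)
  have h2 := zmod2_cancel (x 2)
  have h3 := zmod2_cancel (x 3)
  have h4 := zmod2_cancel (x 4)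
  have h5 := zmod2_cancel (x 5)
  rw [deg5, sum_P5]
  fin_cases i <;> simp [pr, cyc5]
  · linear_combination h0 + h1 + h2 + h3 + h4 + h5
  · linear_combination h0 + h1 + h2
  · linear_combination h0 + h3 + h4
  · linear_combination h1 + h3 + h5
  · linear_combination h2 + h4 + h5

theorem cyc5_inj : Function.Injective cyc5 := by
  intro x x' h
  funext i
  fin_cases i
  · exact congrFun h (pr 1 2 (by decide))
  · exact congrFun h (pr 1 3 (by decide))
  · exact congrFun h (pr 1 4 (by decide))
  · exact congrFun h (pr 2 3 (by decide))
  · exact congrFun h (pr 2 4 (by decide))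
  · exact congrFun h (pr 3 4 (by decide))

theorem dual_no_K5 {V E F : Type} [Fintype V] [Fintype E] [Finite F] [DecidableEq V]
    (src tgt : E → V) (l r : E → F) (hD : Dual src tgt l r)
    (G : SimpleGraph V) (hG : ∀ x y, G.Adj x y → ∃ e, Joins src tgt e x y) :
    ¬ HasCliqueMinor G 5 := by
  classical
  rintro ⟨μ, hμ, hdis, hadj⟩
  have hadj' : ∀ p : P5, ∃ e a b, a ∈ μ p.1.1 ∧ b ∈ μ p.1.2 ∧ Joins src tgt e a b := by
    rintro ⟨⟨i, j⟩, h⟩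
    obtain ⟨a, ha, b, hb, hab⟩ := hadj i j (ne_of_lt h)
    obtain ⟨e, he⟩ := hG a b hab
    exact ⟨e, a, b, ha, hb, he⟩
  choose ε a b ha hb hε using hadj'
  have huniq : ∀ v i j, v ∈ μ i → v ∈ μ j → i = j := by
    intro v i j hi hj
    by_contra hne
    exact Set.disjoint_left.1 (hdis i j hne) hi hj
  -- indicator of branch sets
  have hind : ∀ v i j, v ∈ μ j → (if v ∈ μ i then (1 : ZMod 2) else 0) = if j = i then 1 else 0 := by
    intro v i j hv
    by_cases h : j = i
    · subst h; simp [hv]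
    · have : v ∉ μ i := fun h' => h (huniq v j i hv h')
      simp [h, this]
  have hεind : ∀ p i, (if src (ε p) ∈ μ i then (1 : ZMod 2) else 0) + (if tgt (ε p) ∈ μ i then 1 else 0)
      = (if p.1.1 = i then 1 else 0) + (if p.1.2 = i then 1 else 0) := by
    intro p i
    rcases hε p with ⟨h1, h2⟩ | ⟨h1, h2⟩
    · rw [h1, h2, hind _ i _ (ha p), hind _ i _ (hb p)]
    · rw [h1, h2, hind _ i _ (ha p), hind _ i _ (hb p), add_comm]
  have hεout : ∀ p i, ¬ (src (ε p) ∈ μ i ∧ tgt (ε p) ∈ μ i) := by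
    rintro p i ⟨h1, h2⟩
    have hne : p.1.1 ≠ p.1.2 := ne_of_lt p.2
    rcases hε p with ⟨h3, h4⟩ | ⟨h3, h4⟩
    · rw [h3] at h1; rw [h4] at h2
      exact hne ((huniq _ _ _ (ha p) h1).trans (huniq _ _ _ (hb p) h2).symm)
    · rw [h3] at h1; rw [h4] at h2
      exact hne ((huniq _ _ _ (ha p) h2).trans (huniq _ _ _ (hb p) h1).symm)
  have hεinj : Function.Injective ε := by
    intro p q hpq
    have h1 := hε p
    have h2 := hε q
    rw [← hpq] at h2
    have hp := p.2
    have hq := q.2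
    have : p.1 = q.1 := by
      rcases h1 with ⟨h3, h4⟩ | ⟨h3, h4⟩ <;> rcases h2 with ⟨h5, h6⟩ | ⟨h5, h6⟩
      · have e1 := huniq _ _ _ (ha p) (by rw [← h3, h5]; exact ha q)
        have e2 := huniq _ _ _ (hb p) (by rw [← h4, h6]; exact hb q)
        exact Prod.ext e1 e2
      · have e1 := huniq _ _ _ (ha p) (by rw [← h3, h5]; exact hb q)
        have e2 := huniq _ _ _ (hb p) (by rw [← h4, h6]; exact ha q)
        rw [e1, e2] at hp
        exact absurd hp (not_lt.2 hq.le)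
      · have e1 := huniq _ _ _ (ha p) (by rw [← h4, h6]; exact hb q)
        have e2 := huniq _ _ _ (hb p) (by rw [← h3, h5]; exact ha q)
        rw [e1, e2] at hp
        exact absurd hp (not_lt.2 hq.le)
      · have e1 := huniq _ _ _ (ha p) (by rw [← h4, h6]; exact ha q)
        have e2 := huniq _ _ _ (hb p) (by rw [← h3, h5]; exact hb q)
        exact Prod.ext e1 e2
    exact Subtype.ext this
  -- deleted edges
  let D : E → Prop := fun e => (∀ i, ¬ (src e ∈ μ i ∧ tgt e ∈ μ i)) ∧ ∀ p, ε p ≠ e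
  have claimA : ∀ S : F → ZMod 2, (∀ e, D e → S (l e) = S (r e)) →
      ∀ i, deg5 (fun p => S (l (ε p)) + S (r (ε p))) i = 0 := by
    intro S hS i
    have hz := (hD (fun e => S (l e) + S (r e))).2 ⟨S, fun e => rfl⟩
    have h0 : ∑ v ∈ Finset.univ.filter (fun v => v ∈ μ i), bdry src tgt (fun e => S (l e) + S (r e)) v = 0 :=
      Finset.sum_eq_zero (fun v _ => hz v)
    simp only [bdry] at h0
    rw [Finset.sum_comm] at h0
    have h1 : ∀ e, ∑ v ∈ Finset.univ.filter (fun v => v ∈ μ i),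
        (S (l e) + S (r e)) * ((if src e = v then 1 else 0) + (if tgt e = v then 1 else 0)) =
        (S (l e) + S (r e)) * ((if src e ∈ μ i then 1 else 0) + (if tgt e ∈ μ i then 1 else 0)) := by
      intro e
      rw [← Finset.mul_sum, Finset.sum_add_distrib]
      simp
    simp only [h1] at h0
    rw [← Finset.sum_subset (Finset.subset_univ (Finset.univ.image ε))] at h0
    · rw [Finset.sum_image (fun _ _ _ _ h => hεinj h)] at h0
      refine Eq.trans ?_ h0
      rw [deg5]
      refine Finset.sum_congr rfl fun p _ => ?_
      rw [hεind]
    · intro e _ he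
      by_cases hDe : D e
      · rw [hS e hDe, zmod2_cancel, zero_mul]
      · have : ∃ j, src e ∈ μ j ∧ tgt e ∈ μ j := by
          by_contra hcon
          push Not at hcon
          apply hDe
          refine ⟨fun j hj => hcon j hj.1 hj.2, fun p hp => he ?_⟩
          rw [← hp]
          exact Finset.mem_image_of_mem _ (Finset.mem_univ _)
        obtain ⟨j, hj1, hj2⟩ := this
        rw [hind _ i _ hj1, hind _ i _ hj2, zmod2_cancel, mul_zero]
  have claimB : ∀ y : P5 → ZMod 2, (∀ i, deg5 y i = 0) →
      ∃ S : F → ZMod 2, (∀ e, D e → S (l e) = S (r e)) ∧ ∀ p, S (l (ε p)) + S (r (ε p)) = y p := by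
    intro y hy
    choose rt hrt using fun i => (hμ i).1
    have hpa : ∀ p : P5, ∃ z : E → ZMod 2, (∀ e, z e ≠ 0 → src e ∈ μ p.1.1 ∧ tgt e ∈ μ p.1.1) ∧
      ∀ v, bdry src tgt z v = (if a p = v then 1 else 0) + (if rt p.1.1 = v then 1 else 0) :=
      fun p => path_vec src tgt G hG (μ p.1.1) (hμ _).2 _ _ (ha p) (hrt _)
    have hpb : ∀ p : P5, ∃ z : E → ZMod 2, (∀ e, z e ≠ 0 → src e ∈ μ p.1.2 ∧ tgt e ∈ μ p.1.2) ∧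
      ∀ v, bdry src tgt z v = (if b p = v then 1 else 0) + (if rt p.1.2 = v then 1 else 0) :=
      fun p => path_vec src tgt G hG (μ p.1.2) (hμ _).2 _ _ (hb p) (hrt _)
    choose za hza hza' using hpa
    choose zb hzb hzb' using hpb
    let z : E → ZMod 2 := ∑ p, y p • (Pi.single (ε p) 1 + (za p + zb p))
    have hzc : ∀ v, bdry src tgt z v = 0 := by
      intro v
      have h1 : bdry src tgt z v = ∑ p, y p * ((if rt p.1.1 = v then 1 else 0) + (if rt p.1.2 = v then 1 else 0)) := by
        rw [bdry_sum]
        refine Finset.sum_congr rfl fun p _ => ?_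
        rw [bdry_smul, bdry_add, bdry_add, hza', hzb', bdry_joins src tgt _ _ _ v (hε p)]
        have e1 := zmod2_cancel (if a p = v then 1 else 0)
        have e2 := zmod2_cancel (if b p = v then 1 else 0)
        linear_combination y p * e1 + y p * e2
      have h2 : ∀ j : Fin 5, (if rt j = v then (1 : ZMod 2) else 0) =
          ∑ i, (if rt i = v then 1 else 0) * (if j = i then 1 else 0) := by
        intro j; simp
      rw [h1]
      have h3 : ∀ p : P5, y p * ((if rt p.1.1 = v then 1 else 0) + (if rt p.1.2 = v then 1 else 0)) =
          ∑ i, (if rt i = v then 1 else 0) * (y p * ((if p.1.1 = i then 1 else 0) + (if p.1.2 = i then 1 else 0))) := by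
        intro p
        rw [h2 p.1.1, h2 p.1.2, ← Finset.sum_add_distrib, Finset.mul_sum]
        refine Finset.sum_congr rfl fun i _ => ?_
        ring
      simp only [h3]
      rw [Finset.sum_comm]
      refine Finset.sum_eq_zero fun i _ => ?_
      rw [← Finset.mul_sum]
      have := hy i
      rw [deg5] at this
      rw [this, mul_zero]
    have hzapp : ∀ e, z e = ∑ p, y p * ((if e = ε p then 1 else 0) + (za p e + zb p e)) := by
      intro e
      simp [z, Finset.sum_apply, Pi.single_apply, mul_add]
    have hza0 : ∀ p e, (∀ i, ¬ (src e ∈ μ i ∧ tgt e ∈ μ i)) → za p e = 0 ∧ zb p e = 0 := by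
      intro p e h
      exact ⟨by_contra fun h' => h _ (hza p e h'), by_contra fun h' => h _ (hzb p e h')⟩
    obtain ⟨S, hS⟩ := (hD z).1 hzc
    refine ⟨S, ?_, ?_⟩
    · intro e he
      have : z e = 0 := by
        rw [hzapp]
        refine Finset.sum_eq_zero fun p _ => ?_
        obtain ⟨h1, h2⟩ := hza0 p e he.1
        rw [h1, h2, if_neg (fun h => he.2 p h.symm)]
        simp
      rw [hS] at this
      exact CharTwo.add_eq_zero.1 this
    · intro q
      rw [← hS, hzapp]
      rw [Finset.sum_eq_single q]
      · obtain ⟨h1, h2⟩ := hza0 q (ε q) (hεout q)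
        rw [h1, h2]; simp
      · intro p _ hpq
        obtain ⟨h1, h2⟩ := hza0 p (ε q) (hεout q)
        rw [h1, h2, if_neg (fun h => hpq (hεinj h.symm))]
        simp
      · simp
  -- quotient of the faces
  let st : Setoid F := Relation.EqvGen.setoid (fun f f' => ∃ e, D e ∧ l e = f ∧ r e = f')
  have : Fintype (Quotient st) := Fintype.ofFinite _
  let L : P5 → Quotient st := fun p => Quotient.mk st (l (ε p))
  let R : P5 → Quotient st := fun p => Quotient.mk st (r (ε p))
  let y : Quotient st → P5 → ZMod 2 := fun κ p => (if L p = κ then 1 else 0) + (if R p = κ then 1 else 0)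
  have hy : ∀ κ i, deg5 (y κ) i = 0 := by
    intro κ i
    refine claimA (fun f => if Quotient.mk st f = κ then 1 else 0) ?_ i
    intro e he
    have : Quotient.mk st (l e) = Quotient.mk st (r e) :=
      Quotient.sound (Relation.EqvGen.rel _ _ ⟨e, he, rfl, rfl⟩)
    simp only [this]
  let M := Finset.univ.filter (fun κ => y κ ≠ 0)
  have hMcard : M.card ≤ 6 := by
    have h1 : M.card * 3 ≤ ∑ κ ∈ M, ∑ p, (y κ p).val := by
      rw [← smul_eq_mul]
      apply Finset.card_nsmul_le_sum
      intro κ hκ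
      exact deg5_support _ (hy κ) (Finset.mem_filter.1 hκ).2
    have h2 : ∑ κ ∈ M, ∑ p, (y κ p).val ≤ ∑ κ, ∑ p, (y κ p).val :=
      Finset.sum_le_sum_of_subset (Finset.subset_univ _)
    have h3 : ∑ κ, ∑ p, (y κ p).val ≤ 20 := by
      rw [Finset.sum_comm]
      have h4 : ∀ p, ∑ κ, (y κ p).val ≤ 2 := by
        intro p
        calc ∑ κ, (y κ p).val ≤ ∑ κ, ((if L p = κ then 1 else 0) + (if R p = κ then 1 else 0)) := by
              refine Finset.sum_le_sum fun κ _ => ?_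
              simp only [y]
              split_ifs <;> decide
          _ = 2 := by rw [Finset.sum_add_distrib]; simp
      calc ∑ p, ∑ κ, (y κ p).val ≤ ∑ p : P5, 2 := Finset.sum_le_sum fun p _ => h4 p
        _ = 20 := by decide
    omega
  have hLR : ∀ p, L p ≠ R p → L p ∈ M ∧ R p ∈ M := by
    intro p hp
    constructor
    · refine Finset.mem_filter.2 ⟨Finset.mem_univ _, fun h => ?_⟩
      have := congrFun h p
      simp [y, hp.symm] at this
    · refine Finset.mem_filter.2 ⟨Finset.mem_univ _, fun h => ?_⟩
      have := congrFun h p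
      simp [y, hp] at this
  have hlift : ∀ x : Fin 6 → ZMod 2, ∃ S : Quotient st → ZMod 2, ∀ p, S (L p) + S (R p) = cyc5 x p := by
    intro x
    obtain ⟨S, hS1, hS2⟩ := claimB (cyc5 x) (cyc5_cyc x)
    refine ⟨Quotient.lift S ?_, fun p => hS2 p⟩
    intro f f' hff
    change Relation.EqvGen _ f f' at hff
    induction hff with
    | rel f f' h => obtain ⟨e, he, rfl, rfl⟩ := h; exact hS1 e he
    | refl => rfl
    | symm _ _ _ ih => exact ih.symm
    | trans _ _ _ _ _ ih1 ih2 => exact ih1.trans ih2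
  choose S hS using hlift
  have hne : ∃ κ0, κ0 ∈ M := by
    refine ⟨L (pr 1 2 (by decide)), (hLR _ ?_).1⟩
    intro h
    have := hS (fun _ => 1) (pr 1 2 (by decide))
    rw [h, zmod2_cancel] at this
    simp [cyc5, pr] at this
  obtain ⟨κ0, hκ0⟩ := hne
  let h : (Fin 6 → ZMod 2) → ({κ // κ ∈ M.erase κ0} → ZMod 2) := fun x κ => S x κ.1 + S x κ0
  have hinj : Function.Injective h := by
    intro x x' hxx
    apply cyc5_inj
    have hM : ∀ κ ∈ M, S x κ + S x κ0 = S x' κ + S x' κ0 := by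
      intro κ hκ
      by_cases hk : κ = κ0
      · subst hk; rw [zmod2_cancel, zmod2_cancel]
      · exact congrFun hxx ⟨κ, Finset.mem_erase.2 ⟨hk, hκ⟩⟩
    funext p
    rw [← hS, ← hS]
    by_cases hp : L p = R p
    · rw [hp, zmod2_cancel, zmod2_cancel]
    · obtain ⟨h1, h2⟩ := hLR p hp
      have e1 := hM _ h1
      have e2 := hM _ h2
      have e3 := zmod2_cancel (S x κ0)
      have e4 := zmod2_cancel (S x' κ0)
      linear_combination e1 + e2 - e3 + e4
  have hcard := Fintype.card_le_of_injective h hinj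
  rw [Fintype.card_fun, Fintype.card_fun, Fintype.card_coe, Finset.card_erase_of_mem hκ0, ZMod.card,
    Fintype.card_fin] at hcard
  have := (Nat.pow_le_pow_iff_right (by norm_num : 1 < 2)).1 hcard
  omega


theorem bdry_option {V E : Type} [Fintype E] [DecidableEq V] (src tgt : Option E → V) (z : Option E → ZMod 2) (v : V) :
    bdry src tgt z v = z none * ((if src none = v then 1 else 0) + (if tgt none = v then 1 else 0)) +
      bdry (fun e => src (some e)) (fun e => tgt (some e)) (fun e => z (some e)) v := by
  simp [bdry, Fintype.sum_option]

theorem bdry_some {V E : Type} [Fintype E] [DecidableEq V] (src tgt : E → V) (z : E → ZMod 2) (v : V) :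
    bdry (fun e => some (src e)) (fun e => some (tgt e)) z (some v) = bdry src tgt z v := by
  simp [bdry]

theorem bdry_some_none {V E : Type} [Fintype E] [DecidableEq V] (src tgt : E → V) (z : E → ZMod 2) :
    bdry (fun e => some (src e)) (fun e => some (tgt e)) z none = 0 := by
  simp [bdry]

/-- Add an edge in the face `o`, cutting off the walk `W`. -/
theorem dual_addEdge {V E F : Type} [Fintype E] [DecidableEq V] (src tgt : E → V) (l r : E → F)
    (hD : Dual src tgt l r) (o : F) (W : Finset E) [DecidableEq E] (hW : ∀ e ∈ W, r e = o) (x y : V)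
    (hxy : ∀ v, bdry src tgt (fun e => if e ∈ W then 1 else 0) v =
      (if x = v then 1 else 0) + (if y = v then 1 else 0)) :
    Dual (E := Option E) (F := Option F) (fun e => e.elim x src) (fun e => e.elim y tgt)
      (fun e => e.elim none (fun e => some (l e)))
      (fun e => e.elim (some o) (fun e => if e ∈ W then none else some (r e))) := by
  have key : ∀ (z : Option E → ZMod 2) v, bdry (fun e : Option E => e.elim x src) (fun e => e.elim y tgt) z v =
      bdry src tgt (fun e => z (some e) + z none * (if e ∈ W then 1 else 0)) v := by
    intro z v
    rw [bdry_option]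
    have h1 : (fun e => z (some e) + z none * (if e ∈ W then 1 else 0)) =
      (fun e => z (some e)) + z none • (fun e => if e ∈ W then (1 : ZMod 2) else 0) := by
      funext e; simp
    rw [h1, bdry_add, bdry_smul, hxy, add_comm]
    rfl
  intro z
  simp only [key]
  rw [hD]
  constructor
  · rintro ⟨S, hS⟩
    refine ⟨fun f => f.elim (S o + z none) S, ?_⟩
    intro e
    cases e with
    | none => 
      simp only [Option.elim]
      have := zmod2_cancel (S o)
      linear_combination -this
    | some e =>
      have h1 := hS e
      have h2 := zmod2_cancel (z none)
      by_cases he : e ∈ W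
      · rw [hW e he] at h1
        simp only [he, if_true, Option.elim] at h1 ⊢
        linear_combination h1 - h2
      · simp only [he, if_false, Option.elim] at h1 ⊢
        linear_combination h1
  · rintro ⟨S, hS⟩
    refine ⟨fun f => S (some f), ?_⟩
    intro e
    have h0 := hS none
    have h1 := hS (some e)
    simp only [Option.elim] at h0 h1
    by_cases he : e ∈ W
    · rw [hW e he]
      have h2 := zmod2_cancel (S none)
      simp only [he, if_true] at h1 ⊢
      linear_combination h1 + h0 + h2
    · simp only [he, if_false] at h1 ⊢
      linear_combination h1

/-- Add a pendant edge in the face `o`. -/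
theorem dual_pendant {V E F : Type} [Fintype E] [DecidableEq V] (src tgt : E → V) (l r : E → F)
    (hD : Dual src tgt l r) (o : F) (p : V) :
    Dual (V := Option V) (E := Option E) (F := F) (fun e => e.elim (some p) (fun e => some (src e)))
      (fun e => e.elim none (fun e => some (tgt e)))
      (fun e => e.elim o l) (fun e => e.elim o r) := by
  intro z
  simp only [bdry_option, Option.elim]
  constructor
  · intro h
    have h0 : z none = 0 := by
      have := h none
      rw [bdry_some_none] at this
      simpa using this
    have h1 : ∀ v, bdry src tgt (fun e => z (some e)) v = 0 := by
      intro v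
      have := h (some v)
      rw [bdry_some, h0] at this
      simpa using this
    obtain ⟨S, hS⟩ := (hD _).1 h1
    refine ⟨S, fun e => ?_⟩
    cases e with
    | none => simp only [h0, zmod2_cancel]
    | some e => exact hS e
  · rintro ⟨S, hS⟩
    have h0 : z none = 0 := by rw [hS none]; exact zmod2_cancel _
    have h1 := (hD (fun e => z (some e))).2 ⟨S, fun e => hS (some e)⟩
    intro v
    rw [h0, zero_mul, zero_add]
    cases v with
    | none => exact bdry_some_none _ _ _
    | some v => rw [bdry_some]; exact h1 v

/-- A plane graph in a disc together with (part of) its boundary path. -/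
def Disc {V : Type} (J : V → V → Prop) (B : List V) : Prop :=
  ∃ (E F : Type) (_ : Fintype E) (_ : Finite F) (_ : DecidableEq V) (src tgt : E → V) (l r : E → F) (o : F),
    Dual src tgt l r ∧ (∀ x y, J x y → ∃ e, Joins src tgt e x y) ∧
    B.IsChain (fun p q => ∃ e, Joins src tgt e p q ∧ r e = o) ∧ B.Nodup

theorem Joins.symm {V E : Type} {src tgt : E → V} {e : E} {x y : V} (h : Joins src tgt e x y) :
    Joins src tgt e y x := by
  rcases h with h | h
  · exact Or.inr h
  · exact Or.inl h

theorem Joins.mem {V E : Type} {src tgt : E → V} {e : E} {x y x' y' : V} (h : Joins src tgt e x y)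
    (h' : Joins src tgt e x' y') : (x = x' ∧ y = y') ∨ (x = y' ∧ y = x') := by
  rcases h with ⟨h1, h2⟩ | ⟨h1, h2⟩ <;> rcases h' with ⟨h3, h4⟩ | ⟨h3, h4⟩ <;> subst_vars <;> simp_all

theorem bdry_pair {V E : Type} [Fintype E] [DecidableEq E] [DecidableEq V] (src tgt : E → V) (e1 e2 : E)
    (p v q : V) (hne : e1 ≠ e2) (h1 : Joins src tgt e1 p v) (h2 : Joins src tgt e2 v q) (u : V) :
    bdry src tgt (fun e => if e ∈ ({e1, e2} : Finset E) then 1 else 0) u =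
      (if p = u then 1 else 0) + (if q = u then 1 else 0) := by
  have : (fun e => if e ∈ ({e1, e2} : Finset E) then (1 : ZMod 2) else 0) = Pi.single e1 1 + Pi.single e2 1 := by
    funext e
    by_cases ha : e = e1
    · subst ha; simp [Pi.single_apply, hne]
    · simp [Pi.single_apply, ha]
  rw [this, bdry_add, bdry_joins _ _ _ _ _ _ h1, bdry_joins _ _ _ _ _ _ h2]
  have := zmod2_cancel (if v = u then 1 else 0)
  linear_combination this

theorem Disc.start : Disc (V := Bool) (fun _ _ => False) [true, false] := by
  refine ⟨Unit, Unit, inferInstance, inferInstance, inferInstance, fun _ => true, fun _ => false,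
    fun _ => (), fun _ => (), (), ?_, by simp, ?_, by simp⟩
  · intro z
    constructor
    · intro h
      have := h true
      refine ⟨0, fun e => ?_⟩
      simpa [bdry] using this
    · rintro ⟨S, hS⟩ v
      have := hS ()
      rw [zmod2_cancel] at this
      simp [bdry, this]
  · simp [Joins]

theorem Disc.mono {V : Type} {J J' : V → V → Prop} {B : List V} (h : Disc J B) (hJ : ∀ x y, J' x y → J x y) :
    Disc J' B := by
  obtain ⟨E, F, i1, i2, i3, src, tgt, l, r, o, h1, h2, h3⟩ := h
  exact ⟨E, F, i1, i2, i3, src, tgt, l, r, o, h1, fun x y h => h2 x y (hJ x y h), h3⟩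

theorem Disc.nodup {V : Type} {J : V → V → Prop} {B : List V} (h : Disc J B) : B.Nodup := by
  obtain ⟨E, F, i1, i2, i3, src, tgt, l, r, o, h1, h2, h3, h4⟩ := h
  exact h4

theorem Disc.edge {V : Type} {J : V → V → Prop} {B1 B2 : List V} {p q : V} (h : Disc J (B1 ++ p :: q :: B2)) :
    Disc (fun x y => J x y ∨ (x = p ∧ y = q) ∨ (x = q ∧ y = p)) (B1 ++ p :: q :: B2) := by
  obtain ⟨E, F, i1, i2, i3, src, tgt, l, r, o, h1, h2, h3, h4⟩ := h
  refine ⟨E, F, i1, i2, i3, src, tgt, l, r, o, h1, ?_, h3, h4⟩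
  rw [List.isChain_append] at h3
  have h5 := h3.2.1
  rw [List.isChain_cons_cons] at h5
  obtain ⟨e, he, _⟩ := h5.1
  rintro x y (h | ⟨rfl, rfl⟩ | ⟨rfl, rfl⟩)
  · exact h2 x y h
  · exact ⟨e, he⟩
  · exact ⟨e, he.symm⟩


theorem chain_del {V : Type} {R R' : V → V → Prop} {B1 B2 : List V} {p v q : V}
    (h : (B1 ++ p :: v :: q :: B2).IsChain R) (hn : (B1 ++ p :: v :: q :: B2).Nodup)
    (hR : ∀ x y, x ≠ v → y ≠ v → R x y → R' x y) (hpq : R' p q) :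
    (B1 ++ p :: q :: B2).IsChain R' := by
  rw [List.isChain_split, List.isChain_cons_cons, List.isChain_cons_cons] at h
  obtain ⟨h1, h2, h3, h4⟩ := h
  rw [List.isChain_split, List.isChain_cons_cons]
  have hv : v ∉ B1 ++ [p] ∧ v ∉ q :: B2 := by
    simp only [List.nodup_append, List.nodup_cons, List.mem_append, List.mem_cons, List.not_mem_nil, or_false, not_or] at hn ⊢
    refine ⟨⟨fun hv => hn.2.2 v hv v (by simp) rfl, fun (hv : v = p) => hn.2.1.1.1 hv.symm⟩, hn.2.1.2.1⟩
  refine ⟨?_, hpq, ?_⟩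
  · refine List.IsChain.imp_of_mem_imp (fun x y hx hy hxy => hR x y ?_ ?_ hxy) h1
    · rintro rfl; exact hv.1 hx
    · rintro rfl; exact hv.1 hy
  · refine List.IsChain.imp_of_mem_imp (fun x y hx hy hxy => hR x y ?_ ?_ hxy) h4
    · rintro rfl; exact hv.2 hx
    · rintro rfl; exact hv.2 hy

theorem chain_ins {V W : Type} {R : V → V → Prop} {R' : W → W → Prop} {f : V → W} {B1 B2 : List V} {p q : V} {n : W}
    (h : (B1 ++ p :: q :: B2).IsChain R) (hn : (B1 ++ p :: q :: B2).Nodup)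
    (hR : ∀ x y, R x y → ((x ≠ q ∧ y ≠ q) ∨ (x ≠ p ∧ y ≠ p)) → R' (f x) (f y)) (hpn : R' (f p) n) (hnq : R' n (f q)) :
    (B1.map f ++ f p :: n :: f q :: B2.map f).IsChain R' := by
  rw [List.isChain_split, List.isChain_cons_cons] at h
  obtain ⟨h1, h3, h4⟩ := h
  rw [List.isChain_split, List.isChain_cons_cons, List.isChain_cons_cons]
  have hv : q ∉ B1 ++ [p] ∧ p ∉ q :: B2 := by
    simp only [List.nodup_append, List.nodup_cons, List.mem_append, List.mem_cons, List.not_mem_nil, or_false, not_or] at hn ⊢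
    refine ⟨⟨fun hv => hn.2.2 q hv q (by simp) rfl, fun (hv : q = p) => hn.2.1.1.1 hv.symm⟩, hn.2.1.1⟩
  have e1 : B1.map f ++ [f p] = (B1 ++ [p]).map f := by simp
  have e2 : f q :: B2.map f = (q :: B2).map f := by simp
  rw [e1, e2, List.isChain_map, List.isChain_map]
  refine ⟨?_, hpn, hnq, ?_⟩
  · refine List.IsChain.imp_of_mem_imp (fun x y hx hy hxy => hR x y hxy (Or.inl ⟨?_, ?_⟩)) h1
    · rintro rfl; exact hv.1 hx
    · rintro rfl; exact hv.1 hy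
  · refine List.IsChain.imp_of_mem_imp (fun x y hx hy hxy => hR x y hxy (Or.inr ⟨?_, ?_⟩)) h4
    · rintro rfl; exact hv.2 hx
    · rintro rfl; exact hv.2 hy

theorem Disc.del {V : Type} {J : V → V → Prop} {B1 B2 : List V} {p v q : V}
    (h : Disc J (B1 ++ p :: v :: q :: B2)) : Disc J (B1 ++ p :: q :: B2) := by
  classical
  obtain ⟨E, F, i1, i2, i3, src, tgt, l, r, o, h1, h2, h3, h4⟩ := h
  have h5 := h3
  rw [List.isChain_split, List.isChain_cons_cons, List.isChain_cons_cons] at h5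
  obtain ⟨_, ⟨e1, he1, ho1⟩, ⟨e2, he2, ho2⟩, _⟩ := h5
  have hpv : p ≠ v ∧ p ≠ q ∧ v ≠ q := by
    have h6 := (List.nodup_append.1 h4).2.1
    simp only [List.nodup_cons, List.mem_cons, not_or] at h6
    exact ⟨h6.1.1, h6.1.2.1, h6.2.1.1⟩
  have hne : e1 ≠ e2 := by
    rintro rfl
    rcases he1.mem he2 with h | h
    · exact hpv.1 h.1
    · exact hpv.2.1 h.1
  refine ⟨Option E, Option F, inferInstance, inferInstance, i3, _, _, _, _, some o,
    dual_addEdge src tgt l r h1 o {e1, e2} (by simp [ho1, ho2]) p q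
      (bdry_pair src tgt e1 e2 p v q hne he1 he2), ?_, ?_, ?_⟩
  · intro x y hxy
    obtain ⟨e, he⟩ := h2 x y hxy
    exact ⟨some e, he⟩
  · refine chain_del h3 h4 ?_ ⟨none, Or.inl ⟨rfl, rfl⟩, rfl⟩
    rintro x y hx hy ⟨e, he, hr⟩
    refine ⟨some e, he, ?_⟩
    have : e ∉ ({e1, e2} : Finset E) := by
      simp only [Finset.mem_insert, Finset.mem_singleton, not_or]
      constructor
      · rintro rfl
        rcases he.mem he1 with h | h
        · exact hy h.2
        · exact hx h.1
      · rintro rfl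
        rcases he.mem he2 with h | h
        · exact hx h.1
        · exact hy h.2
    simpa [hr] using this
  · refine h4.sublist ?_
    exact List.Sublist.append_left (List.Sublist.cons_cons _ (List.sublist_cons_self _ _)) _

theorem dual_swap {V E F : Type} [Fintype E] [DecidableEq V] [DecidableEq E] (src tgt : E → V) (l r : E → F)
    (hD : Dual src tgt l r) (e0 : E) :
    Dual src tgt (fun e => if e = e0 then r e else l e) (fun e => if e = e0 then l e else r e) := by
  intro z
  rw [hD]
  refine exists_congr fun S => forall_congr' fun e => ?_
  by_cases h : e = e0
  · simp [h, add_comm]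
  · simp [h]

theorem Disc.ins {V : Type} {J : V → V → Prop} {B1 B2 : List V} {p q : V}
    (h : Disc J (B1 ++ p :: q :: B2)) :
    Disc (V := Option V) (fun x y => ∃ a b, x = some a ∧ y = some b ∧ J a b)
      (B1.map some ++ some p :: none :: some q :: B2.map some) := by
  classical
  obtain ⟨E, F, i1, i2, i3, src, tgt, l, r, o, h1, h2, h3, h4⟩ := h
  have h5 := h3
  rw [List.isChain_split, List.isChain_cons_cons] at h5
  obtain ⟨_, ⟨e1, he1, ho1⟩, _⟩ := h5
  have he1' : Joins (fun e : Option E => e.elim (some p) (fun e => some (src e)))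
      (fun e => e.elim none (fun e => some (tgt e))) (some e1) (some p) (some q) := by
    rcases he1 with ⟨h, h'⟩ | ⟨h, h'⟩
    · left; simp [h, h']
    · right; simp [h, h']
  refine ⟨Option (Option E), Option F, inferInstance, inferInstance, inferInstance, _, _, _, _, some o,
    dual_swap _ _ _ _ (dual_addEdge _ _ _ _ (dual_pendant src tgt l r h1 o p) o {none, some e1} (by simp [ho1]) none (some q)
      (bdry_pair _ _ none (some e1) none (some p) (some q) (by simp) (Or.inr ⟨rfl, rfl⟩) he1')) (some none), ?_, ?_, ?_⟩
  · rintro x y ⟨a, b, rfl, rfl, hxy⟩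
    obtain ⟨e, he⟩ := h2 a b hxy
    refine ⟨some (some e), ?_⟩
    rcases he with ⟨h, h'⟩ | ⟨h, h'⟩
    · left; simp [h, h']
    · right; simp [h, h']
  · refine chain_ins h3 h4 ?_ ⟨some none, Or.inl ⟨rfl, rfl⟩, ?_⟩ ⟨none, Or.inl ⟨rfl, rfl⟩, rfl⟩
    · rintro x y ⟨e, he, hr⟩ hor
      refine ⟨some (some e), ?_, ?_⟩
      · rcases he with ⟨h, h'⟩ | ⟨h, h'⟩
        · left; simp [h, h']
        · right; simp [h, h']
      · have : e ≠ e1 := by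
          rintro rfl
          rcases he.mem he1 with ⟨rfl, rfl⟩ | ⟨rfl, rfl⟩ <;> rcases hor with h | h <;> simp_all
        simpa [hr] using this
    · simp
  · have h6 : (some p :: none :: some q :: B2.map some).Perm (none :: some p :: some q :: B2.map some) := List.Perm.swap _ _ _
    have h7 := (List.Perm.append_left (B1.map some) h6).trans List.perm_middle
    rw [h7.nodup_iff, List.nodup_cons]
    constructor
    · simp
    · have : List.map some B1 ++ some p :: some q :: List.map some B2 = (B1 ++ p :: q :: B2).map some := by simp
      rw [this]
      exact h4.map (Option.some_injective _)


theorem Disc.star {V : Type} {a n w : V} {L : List V} : ∀ {J : V → V → Prop}, Disc J (a :: n :: (L ++ [w])) →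
    Disc (fun x y => J x y ∨ (x = n ∧ y ∈ L) ∨ (y = n ∧ x ∈ L)) (a :: n :: [w]) := by
  induction L with
  | nil => intro J h; exact h.mono (by simp)
  | cons v L ih =>
    intro J h
    have h1 : Disc _ ([a] ++ n :: v :: (L ++ [w])) := Disc.edge (B1 := [a]) (p := n) (q := v) (B2 := L ++ [w]) h
    have h2 : Disc (fun x y => J x y ∨ (x = n ∧ y = v) ∨ (x = v ∧ y = n)) (a :: n :: (L ++ [w])) := by
      cases L with
      | nil => exact Disc.del (B1 := [a]) h1
      | cons v' L => exact Disc.del (B1 := [a]) h1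
    refine (ih h2).mono ?_
    intro x y
    simp only [List.mem_cons]
    tauto

theorem induce_conn_image {V W : Type*} {G : SimpleGraph V} {G' : SimpleGraph W} (f : V → W)
    (hf : ∀ a b, G.Adj a b → G'.Adj (f a) (f b)) {s : Set V} (h : (G.induce s).Connected) :
    (G'.induce (f '' s)).Connected := by
  refine SimpleGraph.Connected.map (G := G.induce s) (H := G'.induce (f '' s))
    ⟨fun x => ⟨f x.1, Set.mem_image_of_mem f x.2⟩, fun {a b} hab => hf _ _ hab⟩ ?_ h
  rintro ⟨_, x, hx, rfl⟩
  exact ⟨⟨x, hx⟩, rfl⟩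

theorem Disc.no_K5 {V : Type} [Fintype V] {G : SimpleGraph V} {B : List V} (h : Disc G.Adj B) : ¬ HasCliqueMinor G 5 := by
  obtain ⟨E, F, i1, i2, i3, src, tgt, l, r, o, h1, h2, h3, h4⟩ := h
  exact dual_no_K5 src tgt l r h1 G h2

theorem Disc.no_rooted {V : Type} [Fintype V] {G : SimpleGraph V} {L : List V} {a w : V}
    (h : Disc G.Adj (a :: (L ++ [w]))) : ¬ HasRootedCliqueMinor G {v | v ∈ L} 4 := by
  rintro ⟨μ, hμ1, hμ2, hμ3⟩
  have h1 : Disc (V := Option V) (fun x y => ∃ a b, x = some a ∧ y = some b ∧ G.Adj a b)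
      (some a :: none :: (L.map some ++ [some w])) := by
    cases L with
    | nil => exact Disc.ins (B1 := []) h
    | cons v L =>
      have := Disc.ins (B1 := []) h
      simpa using this
  have h2 := h1.star
  let G' : SimpleGraph (Option V) :=
    { Adj := fun x y => (∃ a b, x = some a ∧ y = some b ∧ G.Adj a b) ∨ (x = none ∧ y ∈ L.map some) ∨ (y = none ∧ x ∈ L.map some)
      symm := ⟨by
        rintro x y (⟨a, b, h1, h2, h3⟩ | h | h)
        · exact Or.inl ⟨b, a, h2, h1, h3.symm⟩
        · exact Or.inr (Or.inr h)
        · exact Or.inr (Or.inl h)⟩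
      loopless := ⟨by
        rintro x (⟨a, b, h1, h2, h3⟩ | h | h)
        · rw [h1] at h2
          cases h2
          exact G.loopless.irrefl _ h3
        · rw [h.1] at h; simp at h
        · rw [h.1] at h; simp at h⟩ }
  have h3 : Disc G'.Adj _ := h2
  have hn : ∀ i, ∃ b ∈ μ i, b ∈ L := fun i => by
    obtain ⟨b, hb, hb'⟩ := (hμ1 i).1
    exact ⟨b, hb, hb'⟩
  apply h3.no_K5
  refine ⟨Fin.cons {none} (fun i => some '' μ i), ?_, ?_, ?_⟩
  · intro i
    refine Fin.cases ?_ (fun i => ?_) i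
    · simp only [Fin.cons_zero]
      refine ⟨by simp, ?_⟩
      have : Subsingleton ({none} : Set (Option V)) := by
        constructor
        rintro ⟨a, rfl⟩ ⟨b, rfl⟩
        rfl
      have : Nonempty ({none} : Set (Option V)) := ⟨⟨none, rfl⟩⟩
      have hc : (G'.induce ({none} : Set (Option V))).Connected := SimpleGraph.Connected.of_subsingleton
      exact hc
    · simp only [Fin.cons_succ]
      refine ⟨Set.Nonempty.image _ ((hμ1 i).1.mono Set.inter_subset_left), ?_⟩
      exact induce_conn_image some (fun a b hab => Or.inl ⟨a, b, rfl, rfl, hab⟩) (hμ1 i).2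
  · intro i j
    refine Fin.cases ?_ (fun i => ?_) i <;> refine Fin.cases ?_ (fun j => ?_) j
    · simp
    · simp
    · simp
    · intro hij
      simp only [Fin.cons_succ]
      exact (Set.disjoint_image_iff (Option.some_injective _)).2 (hμ2 i j (by simpa using hij))
  · intro i j
    refine Fin.cases ?_ (fun i => ?_) i <;> refine Fin.cases ?_ (fun j => ?_) j
    · simp
    · intro _
      obtain ⟨b, hb, hb'⟩ := hn j
      refine ⟨none, by simp, some b, by simpa using hb, ?_⟩
      exact Or.inr (Or.inl ⟨rfl, List.mem_map_of_mem hb'⟩)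
    · intro _
      obtain ⟨b, hb, hb'⟩ := hn i
      refine ⟨some b, by simpa using hb, none, by simp, ?_⟩
      exact Or.inr (Or.inr ⟨rfl, List.mem_map_of_mem hb'⟩)
    · intro hij
      obtain ⟨a, ha, b, hb, hab⟩ := hμ3 i j (by simpa using hij)
      exact ⟨some a, by simpa using ha, some b, by simpa using hb, Or.inl ⟨a, b, rfl, rfl, hab⟩⟩


theorem Disc.ins' {V : Type} {J : V → V → Prop} {A B : List V} (hA : A ≠ []) (hB : B ≠ [])
    (h : Disc J (A ++ B)) :
    Disc (V := Option V) (fun x y => ∃ a b, x = some a ∧ y = some b ∧ J a b)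
      (A.map some ++ none :: B.map some) := by
  rcases List.eq_nil_or_concat A with rfl | ⟨A, p, rfl⟩
  · exact absurd rfl hA
  · cases B with
    | nil => exact absurd rfl hB
    | cons q B =>
      have := Disc.ins (B1 := A) (p := p) (q := q) (B2 := B) (J := J) (by simpa using h)
      simpa using this

theorem Disc.del' {V : Type} {J : V → V → Prop} {A B : List V} {v : V} (hA : A ≠ []) (hB : B ≠ [])
    (h : Disc J (A ++ v :: B)) : Disc J (A ++ B) := by
  rcases List.eq_nil_or_concat A with rfl | ⟨A, p, rfl⟩
  · exact absurd rfl hA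
  · cases B with
    | nil => exact absurd rfl hB
    | cons q B =>
      have := Disc.del (B1 := A) (p := p) (q := q) (B2 := B) (v := v) (J := J) (by simpa using h)
      simpa using this

/-- The constraint `P` on the names `M` is realized by a plane list-coloring instance with the
names `L` on the boundary. -/
def Rlz {ι : Type} (k : ℕ) (M : Set ι) (L : List ι) (P : (ι → ℕ) → Prop) : Prop :=
  ∃ (V : Type) (_ : Fintype V) (G : SimpleGraph V) (S : V → Set ℕ) (a w : V) (e : ι → V),
    Disc G.Adj (a :: (L.map e ++ [w])) ∧ (∀ v, Set.Icc 1 3 ⊆ S v ∧ S v ⊆ Set.Icc 1 k) ∧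
    (∀ y ∈ L, y ∈ M) ∧
    ∀ c, P c ↔ ∃ g : V → ℕ, (∀ v, g v ∈ S v) ∧ (∀ x y, G.Adj x y → g x ≠ g y) ∧ ∀ y ∈ M, g (e y) = c y

theorem Rlz.start {ι : Type} [Inhabited ι] {k : ℕ} (hk : 3 ≤ k) : Rlz (ι := ι) k ∅ [] (fun _ => True) := by
  refine ⟨Bool, inferInstance, ⊥, fun _ => Set.Icc 1 3, true, false, fun _ => true,
    Disc.start.mono (by simp), fun v => ⟨le_refl _, ?_⟩, by simp, ?_⟩
  · exact Set.Icc_subset_Icc_right hk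
  · intro c
    simp only [true_iff]
    exact ⟨fun _ => 1, by simp⟩

theorem Rlz.mem {ι : Type} {k : ℕ} {M : Set ι} {L : List ι} {P : (ι → ℕ) → Prop} (h : Rlz k M L P) :
    ∀ y ∈ L, y ∈ M := by
  obtain ⟨V, i, G, S, a, w, e, h1, h2, h3, h4⟩ := h
  exact h3

theorem Rlz.nodup {ι : Type} {k : ℕ} {M : Set ι} {L : List ι} {P : (ι → ℕ) → Prop} (h : Rlz k M L P) :
    L.Nodup := by
  obtain ⟨V, i, G, S, a, w, e, h1, h2, h3, h4⟩ := h
  have := h1.nodup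
  rw [List.nodup_cons, List.nodup_append] at this
  exact this.2.1.of_map

theorem Rlz.dep {ι : Type} {k : ℕ} {M : Set ι} {L : List ι} {P : (ι → ℕ) → Prop} (h : Rlz k M L P)
    {c c' : ι → ℕ} (hc : ∀ y ∈ M, c y = c' y) (hP : P c) : P c' := by
  obtain ⟨V, i, G, S, a, w, e, h1, h2, h3, h4⟩ := h
  rw [h4] at hP ⊢
  obtain ⟨g, hg1, hg2, hg3⟩ := hP
  exact ⟨g, hg1, hg2, fun y hy => (hg3 y hy).trans (hc y hy)⟩

theorem Rlz.congr {ι : Type} {k : ℕ} {M : Set ι} {L : List ι} {P P' : (ι → ℕ) → Prop} (h : Rlz k M L P)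
    (hP : ∀ c, P c ↔ P' c) : Rlz k M L P' := by
  have : P = P' := funext fun c => propext (hP c)
  rwa [← this]

theorem Rlz.ins {ι : Type} {k : ℕ} {M : Set ι} {L1 L2 : List ι} {P : (ι → ℕ) → Prop} (h : Rlz k M (L1 ++ L2) P)
    {y : ι} (hy : y ∉ M) {S0 : Set ℕ} (hS : Set.Icc 1 3 ⊆ S0 ∧ S0 ⊆ Set.Icc 1 k) :
    Rlz k (insert y M) (L1 ++ y :: L2) (fun c => P c ∧ c y ∈ S0) := by
  classical
  obtain ⟨V, i, G, S, a, w, e, h1, h2, h3, h4⟩ := h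
  let G' : SimpleGraph (Option V) :=
    { Adj := fun x y => ∃ a b, x = some a ∧ y = some b ∧ G.Adj a b
      symm := ⟨by
        rintro x y ⟨a, b, h1, h2, h3⟩
        exact ⟨b, a, h2, h1, h3.symm⟩⟩
      loopless := ⟨by
        rintro x ⟨a, b, h1, h2, h3⟩
        rw [h1] at h2
        cases h2
        exact G.loopless.irrefl _ h3⟩ }
  have hD : Disc G'.Adj _ := Disc.ins' (A := a :: L1.map e) (B := L2.map e ++ [w]) (by simp) (by simp) (by simpa using h1)
  let e' : ι → Option V := fun x => if x = y then none else some (e x)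
  have he : ∀ x ∈ M, e' x = some (e x) := by
    intro x hx
    have : x ≠ y := by rintro rfl; exact hy hx
    simp [e', this]
  have hey : e' y = none := by simp [e']
  refine ⟨Option V, inferInstance, G', fun v => v.elim S0 S, some a, some w, e', ?_, ?_, ?_, ?_⟩
  · have e1 : L1.map e' = L1.map (some ∘ e) :=
      List.map_congr_left fun x hx => he x (h3 x (by simp [hx]))
    have e2 : L2.map e' = L2.map (some ∘ e) :=
      List.map_congr_left fun x hx => he x (h3 x (by simp [hx]))
    simp only [List.map_append, List.map_cons, e1, e2, hey]
    simpa using hD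
  · intro v
    cases v with
    | none => exact hS
    | some v => exact h2 v
  · intro x hx
    simp only [List.mem_append, List.mem_cons] at hx
    rcases hx with hx | hx | hx
    · exact Or.inr (h3 x (by simp [hx]))
    · exact Or.inl hx
    · exact Or.inr (h3 x (by simp [hx]))
  · intro c
    beta_reduce
    rw [h4]
    constructor
    · rintro ⟨⟨g, hg1, hg2, hg3⟩, hc⟩
      refine ⟨fun v => v.elim (c y) g, ?_, ?_, ?_⟩
      · intro v
        cases v with
        | none => exact hc
        | some v => exact hg1 v
      · rintro _ _ ⟨a, b, rfl, rfl, hab⟩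
        exact hg2 a b hab
      · rintro x (rfl | hx)
        · rw [hey]; rfl
        · rw [he x hx]; exact hg3 x hx
    · rintro ⟨g, hg1, hg2, hg3⟩
      refine ⟨⟨fun v => g (some v), fun v => hg1 (some v), fun x y hxy => hg2 _ _ ⟨x, y, rfl, rfl, hxy⟩, ?_⟩, ?_⟩
      · intro x hx
        have := hg3 x (Or.inr hx)
        rwa [he x hx] at this
      · have h5 := hg3 y (Or.inl rfl)
        have h6 := hg1 none
        rw [hey] at h5
        rw [← h5]
        exact h6

theorem Rlz.edge {ι : Type} {k : ℕ} {M : Set ι} {L1 L2 : List ι} {P : (ι → ℕ) → Prop} {u v : ι}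
    (h : Rlz k M (L1 ++ u :: v :: L2) P) :
    Rlz k M (L1 ++ u :: v :: L2) (fun c => P c ∧ c u ≠ c v) := by
  obtain ⟨V, i, G, S, a, w, e, h1, h2, h3, h4⟩ := h
  have hne : e u ≠ e v := by
    have := h1.nodup
    simp only [List.nodup_cons, List.nodup_append, List.map_append, List.map_cons] at this
    intro h
    simp [h] at this
  have hu : u ∈ M := h3 u (by simp)
  have hv : v ∈ M := h3 v (by simp)
  refine ⟨V, i, G ⊔ SimpleGraph.edge (e u) (e v), S, a, w, e, ?_, h2, h3, ?_⟩
  · have := Disc.edge (B1 := a :: L1.map e) (p := e u) (q := e v) (B2 := L2.map e ++ [w]) (by simpa using h1)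
    have := this.mono (J' := (G ⊔ SimpleGraph.edge (e u) (e v)).Adj) (by
      intro x y hxy
      rw [SimpleGraph.sup_adj, SimpleGraph.edge_adj] at hxy
      grind)
    simpa using this
  · intro c
    beta_reduce
    rw [h4]
    constructor
    · rintro ⟨⟨g, hg1, hg2, hg3⟩, hc⟩
      refine ⟨g, hg1, ?_, hg3⟩
      intro x y hxy
      rw [SimpleGraph.sup_adj, SimpleGraph.edge_adj] at hxy
      rw [← hg3 u hu, ← hg3 v hv] at hc
      rcases hxy with hxy | ⟨⟨h1, h2⟩ | ⟨h1, h2⟩, _⟩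
      · exact hg2 x y hxy
      · rw [h1, h2]; exact hc
      · rw [h1, h2]; exact hc.symm
    · rintro ⟨g, hg1, hg2, hg3⟩
      refine ⟨⟨g, hg1, fun x y hxy => hg2 x y (Or.inl hxy), hg3⟩, ?_⟩
      rw [← hg3 u hu, ← hg3 v hv]
      apply hg2
      rw [SimpleGraph.sup_adj, SimpleGraph.edge_adj]
      exact Or.inr ⟨Or.inl ⟨rfl, rfl⟩, hne⟩

theorem Rlz.del {ι : Type} {k : ℕ} {M : Set ι} {L1 L2 : List ι} {P : (ι → ℕ) → Prop} {u : ι}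
    (h : Rlz k M (L1 ++ u :: L2) P) : Rlz k M (L1 ++ L2) P := by
  obtain ⟨V, i, G, S, a, w, e, h1, h2, h3, h4⟩ := h
  refine ⟨V, i, G, S, a, w, e, ?_, h2, fun y hy => h3 y (by simp at hy ⊢; tauto), h4⟩
  have := Disc.del' (A := a :: L1.map e) (v := e u) (B := L2.map e ++ [w]) (by simp) (by simp) (by simpa using h1)
  simpa using this

theorem Rlz.reindex {ι ι' : Type} {k : ℕ} {M : Set ι} {L : List ι} {P : (ι → ℕ) → Prop}
    (h : Rlz k M L P) (ρ : ι' → ι) {M' : Set ι'} {L' : List ι'} (hL : L'.map ρ = L) (hM : ∀ y ∈ M', ρ y ∈ M)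
    (hL' : ∀ y ∈ L', y ∈ M') {P' : (ι' → ℕ) → Prop} (hP : ∀ c, P' c ↔ ∃ c0, P c0 ∧ ∀ y ∈ M', c0 (ρ y) = c y) :
    Rlz k M' L' P' := by
  subst hL
  obtain ⟨V, i, G, S, a, w, e, h1, h2, h3, h4⟩ := h
  refine ⟨V, i, G, S, a, w, e ∘ ρ, ?_, h2, hL', ?_⟩
  · simpa using h1
  · intro c
    rw [hP]
    constructor
    · rintro ⟨c0, hc, h5⟩
      obtain ⟨g, hg1, hg2, hg3⟩ := (h4 _).1 hc
      exact ⟨g, hg1, hg2, fun y hy => (hg3 _ (hM y hy)).trans (h5 y hy)⟩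
    · rintro ⟨g, hg1, hg2, hg3⟩
      exact ⟨fun y => g (e y), (h4 _).2 ⟨g, hg1, hg2, fun y _ => rfl⟩, hg3⟩


theorem Rlz.ins3 {ι : Type} {k : ℕ} (hk : 3 ≤ k) {M : Set ι} {L : List ι} {P : (ι → ℕ) → Prop} (h : Rlz k M L P)
    (y : ι) (L1 L2 : List ι) (hy : y ∉ M) (hL : L = L1 ++ L2) {L' : List ι} (hL' : L1 ++ y :: L2 = L') :
    Rlz k (insert y M) L' (fun c => P c ∧ c y ∈ Set.Icc 1 3) := by
  subst hL hL'
  exact h.ins hy ⟨le_refl _, Set.Icc_subset_Icc_right hk⟩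

theorem Rlz.edge' {ι : Type} {k : ℕ} {M : Set ι} {L : List ι} {P : (ι → ℕ) → Prop}
    (h : Rlz k M L P) (u v : ι) (L1 L2 : List ι) (hL : L = L1 ++ u :: v :: L2) :
    Rlz k M L (fun c => P c ∧ c u ≠ c v) := by
  subst hL
  exact h.edge

theorem Rlz.del' {ι : Type} {k : ℕ} {M : Set ι} {L : List ι} {P : (ι → ℕ) → Prop} 
    (h : Rlz k M L P) (u : ι) (L1 L2 : List ι) (hL : L = L1 ++ u :: L2) {L' : List ι} (hL' : L1 ++ L2 = L') : Rlz k M L' P := by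
  subst hL hL'
  exact h.del

/-- Three colors form a SET: all equal or all distinct. -/
def SET (a b c : ℕ) : Prop := (a = b ∧ b = c) ∨ (a ≠ b ∧ b ≠ c ∧ a ≠ c)

instance (a b c : ℕ) : Decidable (SET a b c) := by unfold SET; infer_instance

set_option synthInstance.maxSize 10000 in
set_option synthInstance.maxHeartbeats 2000000 in
set_option maxRecDepth 100000 in
theorem set_gadget_ex : ∀ u ∈ Finset.Icc 1 3, ∀ v ∈ Finset.Icc 1 3, ∀ w ∈ Finset.Icc 1 3, SET u v w → 
    ∃ p1 ∈ Finset.Icc 1 3, u ≠ p1 ∧ p1 ≠ v ∧ ∃ p2 ∈ Finset.Icc 1 3, p2 ≠ p1 ∧ 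
    ∃ p3 ∈ Finset.Icc 1 3, p2 ≠ p3 ∧ p3 ≠ p1 ∧ p3 ≠ v ∧ ∃ p4 ∈ Finset.Icc 1 3, u ≠ p4 ∧ p4 ≠ p2 ∧
    ∃ p5 ∈ Finset.Icc 1 3, u ≠ p5 ∧ p5 ≠ p4 ∧ p5 ≠ p3 ∧ w ≠ p5 ∧ w ≠ p3 := by
  decide +kernel

set_option synthInstance.maxSize 10000 in
set_option synthInstance.maxHeartbeats 2000000 in
set_option maxRecDepth 100000 in
theorem set_gadget_all : ∀ u ∈ Finset.Icc 1 3, ∀ v ∈ Finset.Icc 1 3, ∀ w ∈ Finset.Icc 1 3,  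
    ∀ p1 ∈ Finset.Icc 1 3, u ≠ p1 → p1 ≠ v → ∀ p2 ∈ Finset.Icc 1 3, p2 ≠ p1 →
    ∀ p3 ∈ Finset.Icc 1 3, p2 ≠ p3 → p3 ≠ p1 → p3 ≠ v → ∀ p4 ∈ Finset.Icc 1 3, u ≠ p4 → p4 ≠ p2 →
    ∀ p5 ∈ Finset.Icc 1 3, u ≠ p5 → p5 ≠ p4 → p5 ≠ p3 → w ≠ p5 → w ≠ p3 → SET u v w := by
  decide +kernel

/-- Extend the set of names by auxiliary names. -/
theorem Rlz.lift {ι : Type} (κ : Type) [Inhabited ι] {k : ℕ} {M : Set ι} {L : List ι} {P : (ι → ℕ) → Prop} (h : Rlz k M L P) :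
    Rlz (ι := ι ⊕ κ) k (Sum.inl '' M) (L.map Sum.inl) (fun c => P (fun y => c (Sum.inl y))) := by
  refine h.reindex (Sum.elim id (fun _ => default)) ?_ ?_ ?_ ?_
  · simp
  · rintro _ ⟨y, hy, rfl⟩; exact hy
  · intro y hy
    obtain ⟨x, hx, rfl⟩ := List.mem_map.1 hy
    exact ⟨x, h.mem x hx, rfl⟩
  · intro c
    constructor
    · intro hc
      refine ⟨_, hc, ?_⟩
      rintro _ ⟨y, hy, rfl⟩
      rfl
    · rintro ⟨c0, hc, h0⟩
      refine h.dep ?_ hc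
      intro y hy
      exact h0 _ ⟨y, hy, rfl⟩

theorem Rlz.set {ι : Type} {k : ℕ} (hk : 3 ≤ k) {M : Set ι} {L1 L2 : List ι} {P : (ι → ℕ) → Prop} {u v : ι}
    (h : Rlz k M (L1 ++ u :: v :: L2) P) (hP : ∀ c, P c → c u ∈ Finset.Icc 1 3 ∧ c v ∈ Finset.Icc 1 3) (w : ι) (hw : w ∉ M) :
    Rlz k (insert w M) (L1 ++ u :: w :: v :: L2) (fun c => P c ∧ c w ∈ Finset.Icc 1 3 ∧ SET (c u) (c v) (c w)) := by
  classical
  have : Inhabited ι := ⟨u⟩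
  have huM : u ∈ M := h.mem u (by simp)
  have hvM : v ∈ M := h.mem v (by simp)
  have huw : u ≠ w := by rintro rfl; exact hw huM
  have hvw : v ≠ w := by rintro rfl; exact hw hvM
  have h0 := h.lift (Fin 6)
  rw [List.map_append, List.map_cons, List.map_cons] at h0
  have hL := h.mem
  generalize hA : L1.map (Sum.inl (β := Fin 6)) = A at h0
  generalize hB : L2.map (Sum.inl (β := Fin 6)) = B at h0
  let p : Fin 6 → ι ⊕ Fin 6 := Sum.inr
  let U : ι ⊕ Fin 6 := Sum.inl u
  let V : ι ⊕ Fin 6 := Sum.inl v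
  have s1 := h0.ins3 hk (p 1) (A ++ [U]) (V :: B) (by simp [p]) (by simp [U, V]) (L' := A ++ U :: p 1 :: V :: B) (by simp)
  have s1 := s1.edge' U (p 1) A (V :: B) rfl
  have s1 := s1.edge' (p 1) V (A ++ [U]) B (by simp)
  have s2 := s1.ins3 hk (p 2) (A ++ [U]) (p 1 :: V :: B) (by simp [p]) (by simp) (L' := A ++ U :: p 2 :: p 1 :: V :: B) (by simp)
  have s2 := s2.edge' (p 2) (p 1) (A ++ [U]) (V :: B) (by simp)
  have s3 := s2.ins3 hk (p 3) (A ++ [U, p 2]) (p 1 :: V :: B) (by simp [p]) (by simp) (L' := A ++ U :: p 2 :: p 3 :: p 1 :: V :: B) (by simp)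
  have s3 := s3.edge' (p 2) (p 3) (A ++ [U]) (p 1 :: V :: B) (by simp)
  have s3 := s3.edge' (p 3) (p 1) (A ++ [U, p 2]) (V :: B) (by simp)
  have s3 := s3.del' (p 1) (A ++ [U, p 2, p 3]) (V :: B) (by simp) (L' := A ++ U :: p 2 :: p 3 :: V :: B) (by simp)
  have s3 := s3.edge' (p 3) V (A ++ [U, p 2]) B (by simp)
  have s4 := s3.ins3 hk (p 4) (A ++ [U]) (p 2 :: p 3 :: V :: B) (by simp [p]) (by simp) (L' := A ++ U :: p 4 :: p 2 :: p 3 :: V :: B) (by simp)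
  have s4 := s4.edge' U (p 4) A (p 2 :: p 3 :: V :: B) (by simp)
  have s4 := s4.edge' (p 4) (p 2) (A ++ [U]) (p 3 :: V :: B) (by simp)
  have s4 := s4.del' (p 2) (A ++ [U, p 4]) (p 3 :: V :: B) (by simp) (L' := A ++ U :: p 4 :: p 3 :: V :: B) (by simp)
  have s5 := s4.ins3 hk (p 5) (A ++ [U]) (p 4 :: p 3 :: V :: B) (by simp [p]) (by simp) (L' := A ++ U :: p 5 :: p 4 :: p 3 :: V :: B) (by simp)
  have s5 := s5.edge' U (p 5) A (p 4 :: p 3 :: V :: B) (by simp)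
  have s5 := s5.edge' (p 5) (p 4) (A ++ [U]) (p 3 :: V :: B) (by simp)
  have s5 := s5.del' (p 4) (A ++ [U, p 5]) (p 3 :: V :: B) (by simp) (L' := A ++ U :: p 5 :: p 3 :: V :: B) (by simp)
  have s5 := s5.edge' (p 5) (p 3) (A ++ [U]) (V :: B) (by simp)
  have s6 := s5.ins3 hk (p 0) (A ++ [U]) (p 5 :: p 3 :: V :: B) (by simp [p]) (by simp) (L' := A ++ U :: p 0 :: p 5 :: p 3 :: V :: B) (by simp)
  have s6 := s6.edge' (p 0) (p 5) (A ++ [U]) (p 3 :: V :: B) (by simp)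
  have s6 := s6.del' (p 5) (A ++ [U, p 0]) (p 3 :: V :: B) (by simp) (L' := A ++ U :: p 0 :: p 3 :: V :: B) (by simp)
  have s6 := s6.edge' (p 0) (p 3) (A ++ [U]) (V :: B) (by simp)
  have s6 := s6.del' (p 3) (A ++ [U, p 0]) (V :: B) (by simp) (L' := A ++ U :: p 0 :: V :: B) (by simp)
  clear s1 s2 s3 s4 s5 h0
  let ρ : ι → ι ⊕ Fin 6 := fun y => if y = w then p 0 else Sum.inl y
  have hρ : ∀ y ∈ M, ρ y = Sum.inl y := by
    intro y hy
    have : y ≠ w := by rintro rfl; exact hw hy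
    simp [ρ, this]
  have hρw : ρ w = p 0 := by simp [ρ]
  refine s6.reindex ρ ?_ ?_ ?_ ?_
  · have e1 : L1.map ρ = A := by
      rw [← hA]; exact List.map_congr_left fun x hx => hρ x (hL x (by simp [hx]))
    have e2 : L2.map ρ = B := by
      rw [← hB]; exact List.map_congr_left fun x hx => hρ x (hL x (by simp [hx]))
    simp [e1, e2, hρ u huM, hρ v hvM, hρw, U, V]
  · rintro y (rfl | hy)
    · rw [hρw]; simp [p]
    · rw [hρ y hy]; simp [hy]
  · intro y hy
    simp only [List.mem_append, List.mem_cons] at hy hL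
    by_cases h : y = w
    · exact Or.inl h
    · exact Or.inr (hL y (by tauto))
  · intro c
    constructor
    · rintro ⟨hc, hcw, hS⟩
      obtain ⟨p1, a1, a2, a3, p2, b1, b2, p3, c1, c2, c3, c4, p4, d1, d2, d3, p5, e1, e2, e3, e4, e5, e6⟩ :=
        set_gadget_ex _ (hP c hc).1 _ (hP c hc).2 _ hcw hS
      refine ⟨Sum.elim c ![c w, p1, p2, p3, p4, p5], ?_, ?_⟩
      · simp only [Finset.mem_Icc] at *
        simp only [p, U, V, Sum.elim_inl, Sum.elim_inr, Set.mem_Icc]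
        simp only [Matrix.cons_val]
        simp only [and_assoc]
        exact ⟨hc, a1.1, a1.2, a2, a3, b1.1, b1.2, b2, c1.1, c1.2, c2, c3, c4, d1.1, d1.2, d2, d3, e1.1, e1.2, e2, e3, e4, hcw.1, hcw.2, e5, e6⟩
      · rintro y (rfl | hy)
        · rw [hρw]; rfl
        · rw [hρ y hy]; rfl
    · rintro ⟨c0, hc0, h0⟩
      simp only [and_assoc] at hc0
      obtain ⟨hc, a1, a2, a3, b1, b2, c1, c2, c3, c4, d1, d2, d3, e1, e2, e3, e4, hcw, e5, e6⟩ := hc0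
      have hPc : P c := h.dep (fun y hy => by rw [← h0 y (Or.inr hy), hρ y hy]) hc
      have hu := h0 u (Or.inr huM)
      have hv := h0 v (Or.inr hvM)
      have hw' := h0 w (Or.inl rfl)
      rw [hρ u huM] at hu
      rw [hρ v hvM] at hv
      rw [hρw] at hw'
      rw [hw'] at hcw e5 e6
      simp only [U, V, hu, hv] at *
      simp only [← Finset.coe_Icc, Finset.mem_coe] at *
      exact ⟨hPc, hcw, set_gadget_all _ (hP c hPc).1 _ (hP c hPc).2 _ hcw _ a1 a2 a3 _ b1 b2 _ c1 c2 c3 c4 _ d1 d2 d3 _ e1 e2 e3 e4 e5 e6⟩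


theorem set_swap : ∀ u ∈ Finset.Icc 1 3, ∀ v ∈ Finset.Icc 1 3, ∀ w ∈ Finset.Icc 1 3, SET u v w →
    ∀ v' ∈ Finset.Icc 1 3, SET u w v' → ∀ u' ∈ Finset.Icc 1 3, SET w v u' → v' = v ∧ u' = u := by
  decide +kernel

theorem set_third : ∀ u ∈ Finset.Icc 1 3, ∀ v ∈ Finset.Icc 1 3, ∃ w ∈ Finset.Icc 1 3, SET u v w ∧ SET u w v ∧ SET w v u := by
  decide +kernel

theorem Rlz.swap {ι : Type} {k : ℕ} (hk : 3 ≤ k) {M : Set ι} {L1 L2 : List ι} {P : (ι → ℕ) → Prop} {u v : ι}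
    (h : Rlz k M (L1 ++ u :: v :: L2) P) (hP : ∀ c, P c → c u ∈ Finset.Icc 1 3 ∧ c v ∈ Finset.Icc 1 3) :
    Rlz k M (L1 ++ v :: u :: L2) P := by
  classical
  have : Inhabited ι := ⟨u⟩
  have huM : u ∈ M := h.mem u (by simp)
  have hvM : v ∈ M := h.mem v (by simp)
  have hn := h.nodup
  have huv : u ≠ v := by
    rintro rfl
    simp [List.nodup_append] at hn
  have hu1 : u ∉ L1 ∧ u ∉ L2 ∧ v ∉ L1 ∧ v ∉ L2 := by
    simp only [List.nodup_append, List.nodup_cons, List.mem_cons, not_or] at hn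
    exact ⟨fun h => hn.2.2 u h u (by simp) rfl, hn.2.1.1.2, fun h => hn.2.2 v h v (by simp) rfl, hn.2.1.2.1⟩
  have h0 := h.lift (Fin 3)
  rw [List.map_append, List.map_cons, List.map_cons] at h0
  have hL := h.mem
  generalize hA : L1.map (Sum.inl (β := Fin 3)) = A at h0
  generalize hB : L2.map (Sum.inl (β := Fin 3)) = B at h0
  let p : Fin 3 → ι ⊕ Fin 3 := Sum.inr
  let U : ι ⊕ Fin 3 := Sum.inl u
  let V : ι ⊕ Fin 3 := Sum.inl v
  have s1 := h0.set hk (fun c hc => hP _ hc) (p 0) (by simp [p])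
  have s2 := Rlz.set hk (L1 := A) (u := U) (v := p 0) (L2 := V :: B) s1 (fun c hc => ⟨(hP _ hc.1).1, hc.2.1⟩) (p 1) (by simp [p])
  have e2 : A ++ U :: p 1 :: p 0 :: V :: B = A ++ [U, p 1] ++ p 0 :: V :: B := by simp
  rw [e2] at s2
  have s3 := Rlz.set hk (L1 := A ++ [U, p 1]) (u := p 0) (v := V) (L2 := B) s2
    (fun c hc => ⟨hc.1.2.1, (hP _ hc.1.1).2⟩) (p 2) (by simp [p])
  have s3 := s3.del' U A (p 1 :: p 0 :: p 2 :: V :: B) (by simp) (L' := A ++ p 1 :: p 0 :: p 2 :: V :: B) (by simp)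
  have s3 := s3.del' (p 0) (A ++ [p 1]) (p 2 :: V :: B) (by simp) (L' := A ++ p 1 :: p 2 :: V :: B) (by simp)
  have s3 := s3.del' V (A ++ [p 1, p 2]) (B) (by simp) (L' := A ++ p 1 :: p 2 :: B) (by simp)
  clear s1 s2 h0
  let ρ : ι → ι ⊕ Fin 3 := fun y => if y = u then p 2 else if y = v then p 1 else Sum.inl y
  have hρ : ∀ y, y ≠ u → y ≠ v → ρ y = Sum.inl y := by
    intro y hy hy'
    simp [ρ, hy, hy']
  have hρu : ρ u = p 2 := by simp [ρ]
  have hρv : ρ v = p 1 := by simp [ρ, huv.symm]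
  refine s3.reindex ρ ?_ ?_ ?_ ?_
  · have e1 : L1.map ρ = A := by
      rw [← hA]; exact List.map_congr_left fun x hx => hρ x (by rintro rfl; tauto) (by rintro rfl; tauto)
    have e2 : L2.map ρ = B := by
      rw [← hB]; exact List.map_congr_left fun x hx => hρ x (by rintro rfl; tauto) (by rintro rfl; tauto)
    simp [e1, e2, hρu, hρv]
  · intro y hy
    by_cases h1 : y = u
    · subst h1; rw [hρu]; simp
    by_cases h2 : y = v
    · subst h2; rw [hρv]; simp
    rw [hρ y h1 h2]
    simp [hy]
  · intro y hy
    refine hL y ?_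
    simp only [List.mem_append, List.mem_cons] at hy ⊢
    tauto
  · intro c
    constructor
    · intro hc
      obtain ⟨w, hw, hw1, hw2, hw3⟩ := set_third _ (hP c hc).1 _ (hP c hc).2
      have := hP c hc
      refine ⟨Sum.elim c ![w, c v, c u], ?_, ?_⟩
      · simp only [p, U, V, Sum.elim_inl, Sum.elim_inr]
        simp only [Matrix.cons_val]
        exact ⟨⟨⟨hc, hw, hw1⟩, this.2, hw2⟩, this.1, hw3⟩
      · intro y hy
        by_cases h1 : y = u
        · subst h1; rw [hρu]; rfl
        by_cases h2 : y = v
        · subst h2; rw [hρv]; rfl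
        rw [hρ y h1 h2]; rfl
    · rintro ⟨c0, ⟨⟨⟨hc, hw, hw1⟩, hv', hw2⟩, hu', hw3⟩, h0⟩
      have hh := set_swap _ (hP _ hc).1 _ (hP _ hc).2 _ hw hw1 _ hv' hw2 _ hu' hw3
      refine h.dep ?_ hc
      intro y hy
      have := h0 y hy
      by_cases h1 : y = u
      · subst h1; rw [hρu, hh.2] at this; exact this
      by_cases h2 : y = v
      · subst h2; rw [hρv, hh.1] at this; exact this
      rw [hρ y h1 h2] at this
      exact this

theorem Rlz.perm {ι : Type} {k : ℕ} (hk : 3 ≤ k) {M : Set ι} {L L' : List ι} (hp : L.Perm L') {P : (ι → ℕ) → Prop} :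
    ∀ (A : List ι), (∀ c, P c → ∀ y ∈ A ++ L, c y ∈ Finset.Icc 1 3) → 
      Rlz k M (A ++ L) P → Rlz k M (A ++ L') P := by
  induction hp with
  | nil => intro A hP h; exact h
  | cons x _ ih =>
    intro A hP h
    have := ih (A ++ [x]) (by simpa using hP) (by simpa using h)
    simpa using this
  | swap x y l =>
    intro A hP h
    exact h.swap hk (fun c hc => ⟨hP c hc _ (by simp), hP c hc _ (by simp)⟩)
  | trans h1 h2 ih1 ih2 =>
    intro A hP h
    refine ih2 A ?_ (ih1 A hP h)
    intro c hc y hy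
    refine hP c hc y ?_
    rw [List.mem_append] at hy ⊢
    rwa [h1.mem_iff]

/-- Realizable constraint on three-colored wires. -/
def R3 {ι : Type} (k : ℕ) (L : List ι) (P : (ι → ℕ) → Prop) : Prop :=
  Rlz k {y | y ∈ L} L P ∧ ∀ c, P c → ∀ y ∈ L, c y ∈ Finset.Icc 1 3

theorem R3.congr {ι : Type} {k : ℕ} {L : List ι} {P P' : (ι → ℕ) → Prop} (h : R3 k L P)
    (hP : ∀ c, P c ↔ P' c) : R3 k L P' := by
  have : P = P' := funext fun c => propext (hP c)
  rwa [← this]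

theorem R3.perm {ι : Type} {k : ℕ} (hk : 3 ≤ k) {L L' : List ι} (hp : L.Perm L') {P : (ι → ℕ) → Prop} (h : R3 k L P) :
    R3 k L' P := by
  refine ⟨?_, fun c hc y hy => h.2 c hc y (hp.mem_iff.2 hy)⟩
  have := Rlz.perm hk hp [] h.2 h.1
  have e : {y | y ∈ L'} = {y | y ∈ L} := by ext y; exact hp.mem_iff.symm
  rw [e]
  exact this

theorem R3.new {ι : Type} {k : ℕ} (hk : 3 ≤ k) {L : List ι} {P : (ι → ℕ) → Prop} (h : R3 k L P) (w : ι) (hw : w ∉ L) :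
    R3 k (w :: L) (fun c => P c ∧ c w ∈ Finset.Icc 1 3) := by
  constructor
  · have := h.1.ins3 hk w [] L hw rfl (L' := w :: L) rfl
    have e : {y | y ∈ w :: L} = insert w {y | y ∈ L} := by ext y; simp
    rw [e]
    exact this.congr (by simp)
  · rintro c ⟨hc, hc'⟩ y hy
    rcases List.mem_cons.1 hy with rfl | hy
    · exact hc'
    · exact h.2 c hc y hy

theorem R3.neq {ι : Type} {k : ℕ} (hk : 3 ≤ k) {L : List ι} {P : (ι → ℕ) → Prop} (h : R3 k L P) {u v : ι}
    (hu : u ∈ L) (hv : v ∈ L) (huv : u ≠ v) :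
    R3 k L (fun c => P c ∧ c u ≠ c v) := by
  classical
  have hp : L.Perm (u :: v :: (L.erase u).erase v) := by
    refine (List.perm_cons_erase hu).trans (List.Perm.cons _ ?_)
    exact List.perm_cons_erase ((List.mem_erase_of_ne huv.symm).2 hv)
  have h1 := h.perm hk hp
  have h2 : R3 k (u :: v :: (L.erase u).erase v) (fun c => P c ∧ c u ≠ c v) :=
    ⟨h1.1.edge' u v [] _ rfl, fun c hc => h1.2 c hc.1⟩
  exact h2.perm hk hp.symm

theorem R3.nodup {ι : Type} {k : ℕ} {L : List ι} {P : (ι → ℕ) → Prop} (h : R3 k L P) : L.Nodup := h.1.nodup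

theorem R3.dep {ι : Type} {k : ℕ} {L : List ι} {P : (ι → ℕ) → Prop} (h : R3 k L P)
    {c c' : ι → ℕ} (hc : ∀ y ∈ L, c y = c' y) (hP : P c) : P c' := h.1.dep hc hP

open Classical in
theorem R3.proj {ι : Type} {k : ℕ} {L : List ι} {w : ι} {P : (ι → ℕ) → Prop} (h : R3 k (w :: L) P) :
    R3 k L (fun c => ∃ x, P (Function.update c w x)) := by
  have hw := (List.nodup_cons.1 h.nodup).1
  have hne : ∀ y ∈ L, y ≠ w := by rintro y hy rfl; exact hw hy
  constructor
  · refine (h.1.del' w [] L rfl (L' := L) rfl).reindex id (by simp) (fun y (hy : y ∈ L) => List.mem_cons_of_mem w hy) (fun y hy => hy) ?_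
    intro c
    constructor
    · rintro ⟨x, hx⟩
      exact ⟨_, hx, fun y hy => by simp [hne y hy]⟩
    · rintro ⟨c0, hc0, h0⟩
      refine ⟨c0 w, h.dep ?_ hc0⟩
      intro y hy
      by_cases hyw : y = w
      · subst hyw; simp
      · rcases List.mem_cons.1 hy with rfl | hy
        · exact absurd rfl hyw
        · simpa [hyw] using h0 y hy
  · rintro c ⟨x, hx⟩ y hy
    have := h.2 _ hx y (List.mem_cons_of_mem _ hy)
    simpa [hne y hy] using this


/-- `Q` can be imposed on the wires `L`. -/
def Imp {ι : Type} (k : ℕ) (L : List ι) (Q : (ι → ℕ) → Prop) : Prop :=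
  ∀ P, R3 k L P → R3 k L (fun c => P c ∧ Q c)

theorem Imp.congr {ι : Type} {k : ℕ} {L : List ι} {Q Q' : (ι → ℕ) → Prop} (h : Imp k L Q)
    (hQ : ∀ c, (∀ y ∈ L, c y ∈ Finset.Icc 1 3) → (Q c ↔ Q' c)) : Imp k L Q' := by
  intro P hP
  refine (h P hP).congr ?_
  intro c
  exact and_congr_right fun hc => hQ c (hP.2 c hc)

theorem Imp.and {ι : Type} {k : ℕ} {L : List ι} {Q Q' : (ι → ℕ) → Prop} (h : Imp k L Q) (h' : Imp k L Q') :
    Imp k L (fun c => Q c ∧ Q' c) := by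
  intro P hP
  exact (h' _ (h _ hP)).congr fun c => and_assoc

theorem Imp.true {ι : Type} {k : ℕ} {L : List ι} : Imp k L (fun _ => True) := by
  intro P hP
  exact hP.congr (by simp)

theorem Imp.neq {ι : Type} {k : ℕ} (hk : 3 ≤ k) {L : List ι} {u v : ι}
    (hu : u ∈ L) (hv : v ∈ L) (huv : u ≠ v) : Imp k L (fun c => c u ≠ c v) :=
  fun _ hP => hP.neq hk hu hv huv

open Classical in
theorem Imp.ex {ι : Type} {k : ℕ} (hk : 3 ≤ k) {L : List ι} {w : ι} (hw : w ∉ L) {Q : (ι → ℕ) → Prop}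
    (h : Imp k (w :: L) Q) : Imp k L (fun c => ∃ x ∈ Finset.Icc 1 3, Q (Function.update c w x)) := by
  intro P hP
  refine (h _ (hP.new hk w hw)).proj.congr ?_
  intro c
  have hd : ∀ x, P (Function.update c w x) ↔ P c := by
    intro x
    have : ∀ y ∈ L, Function.update c w x y = c y := by
      intro y hy
      have : y ≠ w := by rintro rfl; exact hw hy
      simp [this]
    exact ⟨fun h => hP.dep this h, fun h => hP.dep (fun y hy => (this y hy).symm) h⟩
  simp only [hd, Function.update_self]
  constructor
  · rintro ⟨x, ⟨h1, h2⟩, h3⟩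
    exact ⟨h1, x, h2, h3⟩
  · rintro ⟨h1, x, h2, h3⟩
    exact ⟨x, ⟨h1, h2⟩, h3⟩

theorem clause_num2 : ∀ t0 ∈ Finset.Icc 1 3, ∀ t1 ∈ Finset.Icc 1 3, ∀ t2 ∈ Finset.Icc 1 3, t0 ≠ t1 → t1 ≠ t2 → t0 ≠ t2 →
    ∀ b ∈ Finset.Icc 1 3, ∀ b1 ∈ Finset.Icc 1 3, ∀ w ∈ Finset.Icc 1 3, b ≠ t2 → b1 ≠ t2 →
    ((∃ z ∈ Finset.Icc 1 3, z ≠ b ∧ z ≠ b1 ∧ z ≠ w) ↔ (b ≠ b1 → w ≠ t2)) := by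
  decide +kernel

theorem clause_num01 : ∀ t0 ∈ Finset.Icc 1 3, ∀ t1 ∈ Finset.Icc 1 3, ∀ t2 ∈ Finset.Icc 1 3, t0 ≠ t1 → t1 ≠ t2 → t0 ≠ t2 →
    ∀ b ∈ Finset.Icc 1 3, ∀ b1 ∈ Finset.Icc 1 3, ∀ w ∈ Finset.Icc 1 3, b ≠ t2 → b1 ≠ t2 →
    ((∃ u ∈ Finset.Icc 1 3, (u ≠ w ∧ u ≠ t1) ∧ (b ≠ b1 → u ≠ t2)) ↔ (b ≠ b1 → w ≠ t0)) := by
  decide +kernel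

/-- rainbow condition -/
def Rb {ι : Type} (t : Fin 3 → ι) (c : ι → ℕ) : Prop := c (t 0) ≠ c (t 1) ∧ c (t 1) ≠ c (t 2) ∧ c (t 0) ≠ c (t 2)

theorem Rb.imp {ι : Type} {k : ℕ} (hk : 3 ≤ k) {L : List ι} {t : Fin 3 → ι} (ht : ∀ j, t j ∈ L)
    (hi : Function.Injective t) : Imp k L (Rb t) := by
  refine (Imp.neq hk (ht 0) (ht 1) ?_).and ((Imp.neq hk (ht 1) (ht 2) ?_).and (Imp.neq hk (ht 0) (ht 2) ?_)) <;>
    exact fun h => absurd (hi h) (by decide)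

theorem exists_fresh {ι : Type} [Infinite ι] (L : List ι) : ∃ w, w ∉ L := by
  classical
  obtain ⟨w, hw⟩ := Infinite.exists_notMem_finset L.toFinset
  exact ⟨w, by simpa using hw⟩

/-- base gadget: `b ≠ b1 → w ≠ t2`. -/
theorem gadget2 {ι : Type} [Infinite ι] {k : ℕ} (hk : 3 ≤ k) {L : List ι} {t : Fin 3 → ι} (ht : ∀ j, t j ∈ L)
    (hi : Function.Injective t) {b b1 w : ι} (hb : b ∈ L) (hb1 : b1 ∈ L) (hw : w ∈ L) :
    Imp k L (fun c => (Rb t c ∧ ∃ z ∈ Finset.Icc 1 3, z ≠ c b ∧ z ≠ c b1 ∧ z ≠ c w)) := by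
  classical
  obtain ⟨z, hz⟩ := exists_fresh L
  have hne : ∀ y ∈ L, y ≠ z := by rintro y hy rfl; exact hz hy
  refine (Rb.imp hk ht hi).and ((Imp.ex hk hz (Q := fun c => c z ≠ c b ∧ c z ≠ c b1 ∧ c z ≠ c w) ?_).congr ?_)
  · refine (Imp.neq hk ?_ ?_ ?_).and ((Imp.neq hk ?_ ?_ ?_).and (Imp.neq hk ?_ ?_ ?_)) <;>
      simp [hb, hb1, hw, (hne b hb).symm, (hne b1 hb1).symm, (hne w hw).symm]
  · intro c hc
    simp [Function.update_of_ne (hne b hb), Function.update_of_ne (hne b1 hb1), Function.update_of_ne (hne w hw)]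

theorem gadgetE2 {ι : Type} [Infinite ι] {k : ℕ} (hk : 3 ≤ k) {L : List ι} {t : Fin 3 → ι} (ht : ∀ j, t j ∈ L)
    (hi : Function.Injective t) {b b1 w : ι} (hb : b ∈ L) (hb1 : b1 ∈ L) (hw : w ∈ L)
    (hbt : b ≠ t 2) (hb1t : b1 ≠ t 2) :
    Imp k L (fun c => Rb t c ∧ c b ≠ c (t 2) ∧ c b1 ≠ c (t 2) ∧ (c b ≠ c b1 → c w ≠ c (t 2))) := by
  refine ((gadget2 hk ht hi hb hb1 hw).and ((Imp.neq hk hb (ht 2) hbt).and (Imp.neq hk hb1 (ht 2) hb1t))).congr ?_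
  intro c hc
  have := clause_num2 _ (hc _ (ht 0)) _ (hc _ (ht 1)) _ (hc _ (ht 2))
  constructor
  · rintro ⟨⟨h1, h2⟩, h3, h4⟩
    exact ⟨h1, h3, h4, (this h1.1 h1.2.1 h1.2.2 _ (hc _ hb) _ (hc _ hb1) _ (hc _ hw) h3 h4).1 h2⟩
  · rintro ⟨h1, h3, h4, h2⟩
    exact ⟨⟨h1, (this h1.1 h1.2.1 h1.2.2 _ (hc _ hb) _ (hc _ hb1) _ (hc _ hw) h3 h4).2 h2⟩, h3, h4⟩

theorem clause_num01' {t0 t1 t2 b b1 w : ℕ} (h0 : t0 ∈ Finset.Icc 1 3) (h1 : t1 ∈ Finset.Icc 1 3) (h2 : t2 ∈ Finset.Icc 1 3)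
    (ha : t0 ≠ t1) (hb : t1 ≠ t2) (hc : t0 ≠ t2) (h3 : b ∈ Finset.Icc 1 3) (h4 : b1 ∈ Finset.Icc 1 3) (h5 : w ∈ Finset.Icc 1 3)
    (h6 : b ≠ t2) (h7 : b1 ≠ t2) :
    ((∃ u ∈ Finset.Icc 1 3, (u ≠ w ∧ u ≠ t1) ∧ (b ≠ b1 → u ≠ t2)) ↔ (b ≠ b1 → w ≠ t0)) :=
  clause_num01 _ h0 _ h1 _ h2 ha hb hc _ h3 _ h4 _ h5 h6 h7

theorem gadgetE {ι : Type} [Infinite ι] {k : ℕ} (hk : 3 ≤ k) {L : List ι} {t : Fin 3 → ι} (ht : ∀ j, t j ∈ L)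
    (hi : Function.Injective t) {b b1 w : ι} (hb : b ∈ L) (hb1 : b1 ∈ L) (hw : w ∈ L)
    (hbt : b ≠ t 2) (hb1t : b1 ≠ t 2) (j : Fin 3) :
    Imp k L (fun c => Rb t c ∧ c b ≠ c (t 2) ∧ c b1 ≠ c (t 2) ∧ (c b ≠ c b1 → c w ≠ c (t j))) := by
  classical
  by_cases hj : j = 2
  · subst hj
    exact gadgetE2 hk ht hi hb hb1 hw hbt hb1t
  obtain ⟨u, hu⟩ := exists_fresh L
  have hne : ∀ y ∈ L, y ≠ u := by rintro y hy rfl; exact hu hy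
  obtain ⟨j', hj'⟩ : ∃ j' : Fin 3, (j = 0 ∧ j' = 1) ∨ (j = 1 ∧ j' = 0) := by
    have : j = 0 ∨ j = 1 := by omega
    rcases this with h | h
    · exact ⟨1, Or.inl ⟨h, rfl⟩⟩
    · exact ⟨0, Or.inr ⟨h, rfl⟩⟩
  have h1 : Imp k (u :: L) _ := gadgetE2 hk (L := u :: L) (t := t) (b := b) (b1 := b1) (w := u)
    (fun j => by simp [ht j]) hi (by simp [hb]) (by simp [hb1]) (by simp) hbt hb1t
  have h2 : Imp k (u :: L) (fun c => c u ≠ c w ∧ c u ≠ c (t j')) := by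
    refine (Imp.neq hk ?_ ?_ ?_).and (Imp.neq hk ?_ ?_ ?_) <;>
      simp [hw, ht j', (hne w hw).symm, (hne _ (ht j')).symm]
  refine (Imp.ex hk hu (h2.and h1)).congr ?_
  intro c hc
  simp only [Rb, Function.update_of_ne (hne b hb), Function.update_of_ne (hne b1 hb1), Function.update_of_ne (hne w hw), 
    Function.update_of_ne (hne _ (ht 0)), Function.update_of_ne (hne _ (ht 1)), Function.update_of_ne (hne _ (ht 2)),
    Function.update_of_ne (hne _ (ht j')), Function.update_self]
  have key : Rb t c → c b ≠ c (t 2) → c b1 ≠ c (t 2) → 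
      ((∃ u ∈ Finset.Icc 1 3, (u ≠ c w ∧ u ≠ c (t j')) ∧ (c b ≠ c b1 → u ≠ c (t 2))) ↔ (c b ≠ c b1 → c w ≠ c (t j))) := by
    rintro ⟨r1, r2, r3⟩ h4 h5
    rcases hj' with ⟨rfl, rfl⟩ | ⟨rfl, rfl⟩
    · exact clause_num01' (hc _ (ht 0)) (hc _ (ht 1)) (hc _ (ht 2)) r1 r2 r3 (hc _ hb) (hc _ hb1) (hc _ hw) h4 h5
    · exact clause_num01' (hc _ (ht 1)) (hc _ (ht 0)) (hc _ (ht 2)) r1.symm r3 r2 (hc _ hb) (hc _ hb1) (hc _ hw) h4 h5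
  constructor
  · rintro ⟨x, hx, h1, h2, h3, h4, h5⟩
    exact ⟨h2, h3, h4, (key h2 h3 h4).1 ⟨x, hx, h1, h5⟩⟩
  · rintro ⟨h2, h3, h4, h5⟩
    obtain ⟨x, hx, h6, h7⟩ := (key h2 h3 h4).2 h5
    exact ⟨x, hx, h6, h2, h3, h4, h7⟩

theorem num_two : ∀ t0 ∈ Finset.Icc 1 3, ∀ t1 ∈ Finset.Icc 1 3, ∀ t2 ∈ Finset.Icc 1 3, t0 ≠ t1 → t1 ≠ t2 → t0 ≠ t2 →
    ∀ b ∈ Finset.Icc 1 3, (b ≠ t2 ∧ b ≠ t0 ↔ b = t1) ∧ (b ≠ t2 ∧ b ≠ t1 ↔ b = t0) := by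
  decide +kernel

theorem clause_chain {ι : Type} [Infinite ι] {k : ℕ} (hk : 3 ≤ k) {t : Fin 3 → ι} (hi : Function.Injective t)
    (l : List (ι × Fin 3)) : ∀ (L : List ι) (b : ι), (∀ j, t j ∈ L) → b ∈ L → (∀ j, b ≠ t j) → (∀ p ∈ l, p.1 ∈ L) →
    Imp k L (fun c => Rb t c ∧ c b ≠ c (t 2) ∧ (c b ≠ c (t 1) → ∃ p ∈ l, c p.1 ≠ c (t p.2))) := by
  classical
  induction l with
  | nil =>
    intro L b ht hb hbt _
    refine ((Rb.imp hk ht hi).and ((Imp.neq hk hb (ht 2) (hbt 2)).and (Imp.neq hk hb (ht 0) (hbt 0)))).congr ?_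
    intro c hc
    refine and_congr_right fun hr => ?_
    have := num_two _ (hc _ (ht 0)) _ (hc _ (ht 1)) _ (hc _ (ht 2)) hr.1 hr.2.1 hr.2.2 _ (hc _ hb)
    rw [this.1]
    constructor
    · intro h; rw [h]; exact ⟨hr.2.1, by simp⟩
    · rintro ⟨_, h⟩
      by_contra h'
      obtain ⟨p, hp, _⟩ := h h'
      simp at hp
  | cons q l ih =>
    intro L b ht hb hbt hl
    obtain ⟨b1, hb1⟩ := exists_fresh L
    have hne : ∀ y ∈ L, y ≠ b1 := by rintro y hy rfl; exact hb1 hy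
    have hq : q.1 ∈ L := hl q (by simp)
    have h1 := gadgetE hk (L := b1 :: L) (t := t) (b := b) (b1 := b1) (w := q.1)
      (fun j => by simp [ht j]) hi (by simp [hb]) (by simp) (by simp [hq]) (hbt 2) (hne _ (ht 2)).symm q.2
    have h2 := ih (b1 :: L) b1 (fun j => by simp [ht j]) (by simp) (fun j => (hne _ (ht j)).symm)
      (fun p hp => List.mem_cons_of_mem _ (hl p (by simp [hp])))
    refine (Imp.ex hk hb1 (h1.and h2)).congr ?_
    intro c hc
    have e : ∀ x, (∃ p ∈ l, Function.update c b1 x p.1 ≠ Function.update c b1 x (t p.2)) ↔ ∃ p ∈ l, c p.1 ≠ c (t p.2) := by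
      intro x
      refine exists_congr fun p => and_congr_right fun hp => ?_
      rw [Function.update_of_ne (hne _ (hl p (by simp [hp]))), Function.update_of_ne (hne _ (ht _))]
    simp only [e]
    simp only [Rb, Function.update_of_ne (hne b hb), Function.update_of_ne (hne _ hq), 
      Function.update_of_ne (hne _ (ht _)), Function.update_self]
    constructor
    · rintro ⟨x, hx, ⟨h1, h2, h3, h4⟩, _, _, h5⟩
      refine ⟨h1, h2, fun h6 => ?_⟩
      by_cases h7 : c b = x
      · obtain ⟨p, hp, hp'⟩ := h5 (h7 ▸ h6)
        exact ⟨p, by simp [hp], hp'⟩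
      · exact ⟨q, by simp, h4 h7⟩
    · rintro ⟨h1, h2, h3⟩
      by_cases h4 : c q.1 = c (t q.2)
      · refine ⟨c b, hc _ hb, ⟨h1, h2, h2, by simp⟩, h1, h2, ?_⟩
        intro h5
        obtain ⟨p, hp, hp'⟩ := h3 h5
        rcases List.mem_cons.1 hp with rfl | hp
        · exact absurd h4 hp'
        · exact ⟨p, hp, hp'⟩
      · exact ⟨c (t 1), hc _ (ht 1), ⟨h1, h2, h1.2.1, fun _ => h4⟩, h1, h1.2.1, by simp⟩

theorem clause {ι : Type} [Infinite ι] {k : ℕ} (hk : 3 ≤ k) {t : Fin 3 → ι} (hi : Function.Injective t)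
    (l : List (ι × Fin 3)) (L : List ι) (ht : ∀ j, t j ∈ L) (hl : ∀ p ∈ l, p.1 ∈ L) :
    Imp k L (fun c => Rb t c ∧ ∃ p ∈ l, c p.1 ≠ c (t p.2)) := by
  classical
  obtain ⟨b, hb⟩ := exists_fresh L
  have hne : ∀ y ∈ L, y ≠ b := by rintro y hy rfl; exact hb hy
  have h1 := clause_chain hk hi l (b :: L) b (fun j => by simp [ht j]) (by simp) (fun j => (hne _ (ht j)).symm)
    (fun p hp => List.mem_cons_of_mem _ (hl p hp))
  have h2 : Imp k (b :: L) (fun c => c b ≠ c (t 1)) := Imp.neq hk (by simp) (by simp [ht]) (hne _ (ht 1)).symm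
  refine (Imp.ex hk hb (h1.and h2)).congr ?_
  intro c hc
  have e : ∀ x, (∃ p ∈ l, Function.update c b x p.1 ≠ Function.update c b x (t p.2)) ↔ ∃ p ∈ l, c p.1 ≠ c (t p.2) := by
    intro x
    refine exists_congr fun p => and_congr_right fun hp => ?_
    rw [Function.update_of_ne (hne _ (hl p hp)), Function.update_of_ne (hne _ (ht _))]
  simp only [e]
  simp only [Rb, Function.update_of_ne (hne _ (ht _)), Function.update_self]
  constructor
  · rintro ⟨x, hx, ⟨h1, h2, h3⟩, h4⟩
    exact ⟨h1, h3 h4⟩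
  · rintro ⟨h1, h3⟩
    exact ⟨c (t 0), hc _ (ht 0), ⟨h1, h1.2.2, fun _ => h3⟩, h1.1⟩

theorem clauses {ι : Type} [Infinite ι] {k : ℕ} (hk : 3 ≤ k) {t : Fin 3 → ι} (hi : Function.Injective t)
    (T : List (List (ι × Fin 3))) (L : List ι) (ht : ∀ j, t j ∈ L) (hl : ∀ l ∈ T, ∀ p ∈ l, p.1 ∈ L) :
    Imp k L (fun c => Rb t c ∧ ∀ l ∈ T, ∃ p ∈ l, c p.1 ≠ c (t p.2)) := by
  induction T with
  | nil => exact (Rb.imp hk ht hi).congr (by simp)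
  | cons l T ih =>
    refine ((clause hk hi l L ht (hl l (by simp))).and (ih (fun l hl' => hl l (by simp [hl'])))).congr ?_
    intro c hc
    simp only [List.forall_mem_cons]
    tauto


theorem R3.base {ι : Type} [Inhabited ι] {k : ℕ} (hk : 3 ≤ k) (L : List ι) (hL : L.Nodup) :
    R3 k L (fun c => ∀ y ∈ L, c y ∈ Finset.Icc 1 3) := by
  induction L with
  | nil =>
    have e : {y : ι | y ∈ ([] : List ι)} = ∅ := by ext y; simp
    refine ⟨?_, by simp⟩
    rw [e]
    exact (Rlz.start hk).congr (by simp)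
  | cons w L ih =>
    rw [List.nodup_cons] at hL
    refine ((ih hL.2).new hk w hL.1).congr ?_
    intro c
    rw [List.forall_mem_cons, and_comm]

theorem Imp.main {ι : Type} [Infinite ι] {k : ℕ} (hk : 3 ≤ k) (L : List ι) (Q : (ι → ℕ) → Prop)
    (hQ : ∀ π : ℕ → ℕ, Set.MapsTo π (Set.Icc 1 3) (Set.Icc 1 3) → Set.InjOn π (Set.Icc 1 3) → ∀ c c' : ι → ℕ,
      (∀ y ∈ L, c y ∈ Finset.Icc 1 3) → (∀ y ∈ L, c' y = π (c y)) → Q c → Q c') : Imp k L Q := by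
  classical
  obtain ⟨t2, h2⟩ := exists_fresh L
  obtain ⟨t1, h1⟩ := exists_fresh (t2 :: L)
  obtain ⟨t0, h0⟩ := exists_fresh (t1 :: t2 :: L)
  have hne : ∀ y ∈ L, y ≠ t0 ∧ y ≠ t1 ∧ y ≠ t2 := by
    intro y hy
    refine ⟨?_, ?_, ?_⟩ <;> rintro rfl <;> simp_all
  have h01 : t0 ≠ t1 := by rintro rfl; simp at h0
  have h02 : t0 ≠ t2 := by rintro rfl; simp at h0
  have h12 : t1 ≠ t2 := by rintro rfl; simp at h1
  let t : Fin 3 → ι := ![t0, t1, t2]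
  have hi : Function.Injective t := by
    intro i j hij
    fin_cases i <;> fin_cases j <;> simp_all [t]
  let num : ({y // y ∈ L} → Fin 3) → ι → ℕ := fun τ y => if h : y ∈ L then (τ ⟨y, h⟩ : ℕ) + 1 else 1
  let T : List (List (ι × Fin 3)) := ((Finset.univ.filter fun τ : {y // y ∈ L} → Fin 3 => ¬ Q (num τ)).toList).map
    (fun τ => L.attach.map (fun y => (y.1, τ y)))
  have hT : ∀ c : ι → ℕ, (∀ l ∈ T, ∃ p ∈ l, c p.1 ≠ c (t p.2)) ↔ ∀ τ : {y // y ∈ L} → Fin 3, ¬ Q (num τ) →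
      ∃ y : {y // y ∈ L}, c y.1 ≠ c (t (τ y)) := by
    intro c
    simp [T]
  have h := clauses hk hi T (t0 :: t1 :: t2 :: L) (by intro j; fin_cases j <;> simp [t])
    (by
      intro l hl p hp
      simp only [T, List.mem_map] at hl
      obtain ⟨τ, _, rfl⟩ := hl
      simp only [List.mem_map] at hp
      obtain ⟨y, _, rfl⟩ := hp
      simp [y.2])
  refine (Imp.ex hk h2 (Imp.ex hk h1 (Imp.ex hk h0 h))).congr ?_
  intro c hc
  simp only [hT]
  have hup : ∀ x2 x1 x0, (∀ y ∈ L, Function.update (Function.update (Function.update c t2 x2) t1 x1) t0 x0 y = c y) ∧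
    ∀ j, Function.update (Function.update (Function.update c t2 x2) t1 x1) t0 x0 (t j) = ![x0, x1, x2] j := by
    intro x2 x1 x0
    constructor
    · intro y hy
      simp [hne y hy]
    · intro j
      fin_cases j <;> simp [t, h01, h02, h12, h01.symm, h02.symm, h12.symm]
  constructor
  · rintro ⟨x2, hx2, x1, hx1, x0, hx0, ⟨hr1, hr2, hr3⟩, hall⟩
    obtain ⟨u1, u2⟩ := hup x2 x1 x0
    simp only [u2] at hr1 hr2 hr3 hall
    simp at hr1 hr2 hr3
    have hx : ∀ v ∈ Finset.Icc 1 3, ∃ j : Fin 3, ![x0, x1, x2] j = v := by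
      intro v hv
      simp at hv hx0 hx1 hx2
      have : x0 = v ∨ x1 = v ∨ x2 = v := by omega
      rcases this with h | h | h
      exacts [⟨0, h⟩, ⟨1, h⟩, ⟨2, h⟩]
    have hτ : ∀ y : {y // y ∈ L}, ∃ j : Fin 3, ![x0, x1, x2] j = c y.1 := fun y => hx _ (hc y.1 y.2)
    choose τ hτ using hτ
    have hq : Q (num τ) := by
      by_contra hq
      obtain ⟨y, hy⟩ := hall τ hq
      rw [u1 y.1 y.2, hτ y] at hy
      exact hy rfl
    simp at hx0 hx1 hx2
    refine hQ (fun n => if n = 1 then x0 else if n = 2 then x1 else x2) ?_ ?_ (num τ) c ?_ ?_ hq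
    · intro n hn
      dsimp only
      split_ifs <;> simp <;> omega
    · intro a ha b hb
      simp only [Set.mem_Icc] at ha hb
      dsimp only
      split_ifs <;> omega
    · intro y hy
      simp only [num, dif_pos hy, Finset.mem_Icc]
      omega
    · intro y hy
      rw [← hτ ⟨y, hy⟩]
      simp only [num, dif_pos hy]
      generalize τ ⟨y, hy⟩ = j
      fin_cases j <;> simp
  · intro hq
    refine ⟨3, by simp, 2, by simp, 1, by simp, ?_, ?_⟩
    · simp only [Rb, (hup 3 2 1).2]
      simp
    · intro τ hτ
      simp only [(hup 3 2 1).2]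
      by_contra hcon
      push Not at hcon
      refine hτ (hQ id (fun x hx => hx) (fun x _ y _ h => h) c _ hc ?_ hq)
      intro y hy
      have := hcon ⟨y, hy⟩
      rw [(hup 3 2 1).1 y hy] at this
      rw [id, this]
      simp only [num, dif_pos hy]
      generalize τ ⟨y, hy⟩ = j
      fin_cases j <;> simp

theorem phase1 {ι : Type} [Infinite ι] [Inhabited ι] {k : ℕ} (hk : 3 ≤ k) (L : List ι) (hL : L.Nodup) (Q : (ι → ℕ) → Prop)
    (hQ : ∀ π : ℕ → ℕ, Set.MapsTo π (Set.Icc 1 3) (Set.Icc 1 3) → Set.InjOn π (Set.Icc 1 3) → ∀ c c' : ι → ℕ,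
      (∀ y ∈ L, c y ∈ Finset.Icc 1 3) → (∀ y ∈ L, c' y = π (c y)) → Q c → Q c') :
    Rlz k {y | y ∈ L} L (fun c => (∀ y ∈ L, c y ∈ Finset.Icc 1 3) ∧ Q c) :=
  (Imp.main hk L Q hQ _ (R3.base hk L hL)).1


theorem Rlz.absorb {ι : Type} {k : ℕ} {x : ι} {L1 L2 : List ι} {M : Set ι} (B : List ι) :
    ∀ {P : (ι → ℕ) → Prop}, Rlz k M (L1 ++ x :: (B ++ L2)) P →
      Rlz k M (L1 ++ x :: L2) (fun c => P c ∧ ∀ b ∈ B, c b ≠ c x) := by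
  induction B with
  | nil => intro P h; exact Rlz.congr h (by simp)
  | cons b B ih =>
    intro P h
    have h1 : Rlz k M (L1 ++ x :: b :: (B ++ L2)) P := h
    have h2 := h1.edge.del' b (L1 ++ [x]) (B ++ L2) (by simp) (L' := L1 ++ x :: (B ++ L2)) (by simp)
    refine (ih h2).congr ?_
    intro c
    rw [List.forall_mem_cons, and_assoc]
    constructor
    · rintro ⟨h1, h2, h3⟩; exact ⟨h1, h2.symm, h3⟩
    · rintro ⟨h1, h2, h3⟩; exact ⟨h1, h2.symm, h3⟩

theorem Rlz.collapse {ι : Type} {k : ℕ} {x : ι} {L1 L2 : List ι} {M : Set ι} (B : List ι)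
    {P : (ι → ℕ) → Prop} (h : Rlz k M (L1 ++ (B ++ L2)) P) (hx : x ∉ M) {S0 : Set ℕ}
    (hS : Set.Icc 1 3 ⊆ S0 ∧ S0 ⊆ Set.Icc 1 k) :
    Rlz k (insert x M) (L1 ++ x :: L2) (fun c => P c ∧ c x ∈ S0 ∧ ∀ b ∈ B, c b ≠ c x) :=
  (Rlz.absorb B (h.ins hx hS)).congr fun _ => and_assoc

theorem Rlz.collapses {ι β : Type} {k : ℕ} (B : β → List ι) (X : β → ι) (S : β → Set ℕ) (Bs : List β)
    (hS : ∀ b ∈ Bs, Set.Icc 1 3 ⊆ S b ∧ S b ⊆ Set.Icc 1 k) (hn : (Bs.map X).Nodup) :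
    ∀ {L1 : List ι} {M : Set ι} {P : (ι → ℕ) → Prop}, Rlz k M (L1 ++ Bs.flatMap B) P → (∀ b ∈ Bs, X b ∉ M) →
    Rlz k (M ∪ {x | x ∈ Bs.map X}) (L1 ++ Bs.map X)
      (fun c => P c ∧ ∀ b ∈ Bs, c (X b) ∈ S b ∧ ∀ y ∈ B b, c y ≠ c (X b)) := by
  induction Bs with
  | nil => 
    intro L1 M P h _
    have e : M ∪ {x | x ∈ ([] : List β).map X} = M := by ext; simp
    rw [e]
    exact Rlz.congr h (by simp)
  | cons b Bs ih =>
    intro L1 M P h hX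
    rw [List.map_cons, List.nodup_cons] at hn
    rw [List.flatMap_cons] at h
    have h1 := Rlz.collapse (x := X b) (B b) h (hX b (by simp)) (hS b (by simp))
    have h2 := h1
    rw [show L1 ++ X b :: Bs.flatMap B = (L1 ++ [X b]) ++ Bs.flatMap B by simp] at h2
    have h3 := ih (fun b hb => hS b (by simp [hb])) hn.2 h2 ?_
    · have e : insert (X b) M ∪ {x | x ∈ Bs.map X} = M ∪ {x | x ∈ (b :: Bs).map X} := by
        ext y
        simp only [Set.mem_union, Set.mem_insert_iff, List.map_cons]
        change (y = X b ∨ y ∈ M) ∨ y ∈ Bs.map X ↔ y ∈ M ∨ y ∈ X b :: Bs.map X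
        rw [List.mem_cons]
        tauto
      rw [e] at h3
      have e2 : L1 ++ [X b] ++ Bs.map X = L1 ++ (b :: Bs).map X := by simp
      rw [e2] at h3
      refine h3.congr ?_
      intro c
      rw [List.forall_mem_cons, and_assoc]
    · intro b' hb'
      rw [Set.mem_insert_iff, not_or]
      refine ⟨?_, hX b' (by simp [hb'])⟩
      intro h
      exact hn.1 (h ▸ List.mem_map_of_mem hb')

def Allow (k : ℕ) (Y : ℕ → ℕ → ℕ) (v : ℕ) : Prop :=
  ∀ d, 1 ≤ d → d ≤ k → ∃ z, z ∈ Set.Icc 1 3 ∪ {d} ∧ (∀ j < 3, Y d j ≠ z) ∧ z ≠ v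

/-- the block of wire colors encoding `v`. -/
def Pt (v d j : ℕ) : ℕ :=
  if d = v then (if v ≤ 3 then v else 1) else if j + 1 = d then d % 3 + 1 else j + 1

/-- the intermediate colors encoding `v`. -/
def Zt (v d : ℕ) : ℕ :=
  if d = v then (if v ≤ 3 then v % 3 + 1 else 2) else d

theorem Pt_mem {v d j : ℕ} (hv : 1 ≤ v) (hj : j < 3) : Pt v d j ∈ Finset.Icc 1 3 := by
  rw [Finset.mem_Icc]
  unfold Pt
  split_ifs <;> omega

theorem Zt_spec {v d : ℕ} (hv : 1 ≤ v) : Zt v d ∈ Set.Icc 1 3 ∪ {d} ∧ (∀ j < 3, Pt v d j ≠ Zt v d) ∧ Zt v d ≠ v := by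
  simp only [Set.mem_union, Set.mem_Icc, Set.mem_singleton_iff]
  unfold Pt Zt
  refine ⟨?_, ?_, ?_⟩
  · split_ifs <;> omega
  · intro j hj
    split_ifs <;> omega
  · split_ifs <;> omega

theorem Allow_Pt {k v v' : ℕ} (hv : 1 ≤ v') (hk : v' ≤ k) (h : Allow k (Pt v) v') : v' = v := by
  by_contra hne
  obtain ⟨z, h1, h2, h3⟩ := h v' hv hk
  simp only [Set.mem_union, Set.mem_Icc, Set.mem_singleton_iff] at h1
  have a := h2 0 (by omega)
  have b := h2 1 (by omega)
  have c := h2 2 (by omega)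
  unfold Pt at a b c
  simp only [if_neg hne] at a b c
  split_ifs at a b c <;> omega

theorem inner_inv {k m : ℕ} (hk : 3 ≤ k) {C : Set (Fin m → ℕ)}
    (hC2 : ∀ π : ℕ → ℕ, Set.BijOn π (Set.Icc 1 k) (Set.Icc 1 k) →
      ∀ f ∈ C, (fun i => π (f i)) ∈ C) {π : ℕ → ℕ} (h1 : Set.MapsTo π (Set.Icc 1 3) (Set.Icc 1 3))
    (h2 : Set.InjOn π (Set.Icc 1 3)) {Y Y' : Fin m → ℕ → ℕ → ℕ}
    (hY : ∀ i d j, 1 ≤ d → d ≤ k → j < 3 → Y i d j ∈ Finset.Icc 1 3)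
    (hY' : ∀ i d j, 1 ≤ d → d ≤ k → j < 3 → Y' i d j = π (Y i d j))
    (hQ : ∀ f : Fin m → ℕ, (∀ i, f i ∈ Finset.Icc 1 k) → (∀ i, Allow k (Y i) (f i)) → f ∈ C) :
    ∀ f : Fin m → ℕ, (∀ i, f i ∈ Finset.Icc 1 k) → (∀ i, Allow k (Y' i) (f i)) → f ∈ C := by
  intro f hf hA
  have hs : ∀ n ∈ Set.Icc 1 3, ∃ a ∈ Set.Icc 1 3, π a = n := by
    intro n hn
    have := Finset.surj_on_of_inj_on_of_card_le (s := Finset.Icc 1 3) (t := Finset.Icc 1 3) (fun a _ => π a)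
      (fun a ha => by simpa using h1 (by simpa using ha)) (fun a b ha hb h => h2 (by simpa using ha) (by simpa using hb) h)
      le_rfl n (by simpa using hn)
    obtain ⟨a, ha, h⟩ := this
    exact ⟨a, by simpa using ha, h.symm⟩
  choose! π' hp1 hp2 using hs
  let σ : ℕ → ℕ := fun n => if 1 ≤ n ∧ n ≤ 3 then π n else n
  let σ' : ℕ → ℕ := fun n => if 1 ≤ n ∧ n ≤ 3 then π' n else n
  have hσ : ∀ n, n ∈ Set.Icc 1 3 → σ n = π n := fun n hn => if_pos hn
  have hσn : ∀ n, n ∉ Set.Icc 1 3 → σ n = n := fun n hn => if_neg hn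
  have hσ' : ∀ n, n ∈ Set.Icc 1 3 → σ' n = π' n := fun n hn => if_pos hn
  have hσ'n : ∀ n, n ∉ Set.Icc 1 3 → σ' n = n := fun n hn => if_neg hn
  have hinv : ∀ n, σ (σ' n) = n := by
    intro n
    by_cases hn : n ∈ Set.Icc 1 3
    · rw [hσ' n hn, hσ _ (hp1 n hn), hp2 n hn]
    · rw [hσ'n n hn, hσn n hn]
  have hinj : Function.Injective σ := by
    intro a b hab
    by_cases ha : a ∈ Set.Icc 1 3 <;> by_cases hb : b ∈ Set.Icc 1 3
    · rw [hσ a ha, hσ b hb] at hab; exact h2 ha hb hab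
    · rw [hσ a ha, hσn b hb] at hab; exact absurd (hab ▸ h1 ha) hb
    · rw [hσn a ha, hσ b hb] at hab; exact absurd (hab ▸ h1 hb) ha
    · rwa [hσn a ha, hσn b hb] at hab
  have hkk : Set.Icc 1 3 ⊆ Set.Icc 1 k := Set.Icc_subset_Icc_right hk
  have hmap' : ∀ n ∈ Set.Icc 1 k, σ' n ∈ Set.Icc 1 k := by
    intro n hn
    by_cases h : n ∈ Set.Icc 1 3
    · rw [hσ' n h]; exact hkk (hp1 n h)
    · rwa [hσ'n n h]
  have hmap : ∀ n ∈ Set.Icc 1 k, σ n ∈ Set.Icc 1 k := by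
    intro n hn
    by_cases h : n ∈ Set.Icc 1 3
    · rw [hσ n h]; exact hkk (h1 h)
    · rwa [hσn n h]
  have hB : Set.BijOn σ (Set.Icc 1 k) (Set.Icc 1 k) :=
    ⟨hmap, hinj.injOn, fun n hn => ⟨σ' n, hmap' n hn, hinv n⟩⟩
  have hg : (fun i => σ' (f i)) ∈ C := by
    refine hQ _ ?_ ?_
    · intro i
      have := hmap' (f i) (by simpa using hf i)
      simpa using this
    · intro i d hd hdk
      obtain ⟨z, hz1, hz2, hz3⟩ := hA i d hd hdk
      refine ⟨σ' z, ?_, ?_, ?_⟩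
      · by_cases h : z ∈ Set.Icc 1 3
        · rw [hσ' z h]; exact Or.inl (hp1 z h)
        · rw [hσ'n z h]; exact hz1
      · intro j hj h
        apply hz2 j hj
        rw [hY' i d j hd hdk hj, ← hσ _ (by simpa using hY i d j hd hdk hj), h, hinv]
      · intro h
        apply hz3
        have := congrArg σ h
        rwa [hinv, hinv] at this
  have := hC2 σ hB _ hg
  simpa only [hinv] using this

theorem phase2 {k m : ℕ} (hk : 3 ≤ k) {C : Set (Fin m → ℕ)}
    (hC1 : ∀ f ∈ C, ∀ i, f i ∈ Finset.Icc 1 k)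
    (hC2 : ∀ π : ℕ → ℕ, Set.BijOn π (Set.Icc 1 k) (Set.Icc 1 k) →
      ∀ f ∈ C, (fun i => π (f i)) ∈ C) :
    Rlz k Set.univ (List.finRange m) (fun f => f ∈ C) := by
  let y : (ℕ × ℕ) → ℕ → ℕ × (ℕ × ℕ) × ℕ := fun p j => (0, p, j)
  let z : (ℕ × ℕ) → ℕ × (ℕ × ℕ) × ℕ := fun p => (1, p, 0)
  let x : ℕ → ℕ × (ℕ × ℕ) × ℕ := fun i => (2, (i, 0), 0)
  have hyi : Function.Injective (fun q : (ℕ × ℕ) × ℕ => y q.1 q.2) := by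
    rintro ⟨⟨a, b⟩, c⟩ ⟨⟨a', b'⟩, c'⟩ h; simpa [y] using h
  have hzi : Function.Injective z := by
    rintro ⟨a, b⟩ ⟨a', b'⟩ h; simpa [z] using h
  have hxi : Function.Injective x := by
    rintro a a' h; simpa [x] using h
  let Pm : List (ℕ × ℕ) := (List.range m).product (List.range' 1 k)
  have hPm : ∀ p, p ∈ Pm ↔ p.1 < m ∧ 1 ≤ p.2 ∧ p.2 ≤ k := by
    rintro ⟨i, d⟩
    simp only [Pm, List.pair_mem_product, List.mem_range, List.mem_range'_1]
    omega
  have hPn : Pm.Nodup := List.nodup_range.product List.nodup_range'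
  let L0 := (Pm.product (List.range 3)).map (fun q => y q.1 q.2)
  have hL0 : L0.Nodup := (hPn.product List.nodup_range).map hyi
  have hm0 : ∀ p j, p ∈ Pm → j < 3 → y p j ∈ L0 := by
    intro p j hp hj
    exact List.mem_map.2 ⟨(p, j), List.pair_mem_product.2 ⟨hp, List.mem_range.2 hj⟩, rfl⟩
  have hm0' : ∀ w ∈ L0, ∃ p ∈ Pm, ∃ j < 3, w = y p j := by
    intro w hw
    obtain ⟨⟨p, j⟩, h, rfl⟩ := List.mem_map.1 hw
    rw [List.pair_mem_product, List.mem_range] at h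
    exact ⟨p, h.1, j, h.2, rfl⟩
  let Q : (ℕ × (ℕ × ℕ) × ℕ → ℕ) → Prop := fun c => ∀ f : Fin m → ℕ, (∀ i, f i ∈ Finset.Icc 1 k) →
    (∀ i : Fin m, Allow k (fun d j => c (y (i, d) j)) (f i)) → f ∈ C
  have h0 := phase1 hk L0 hL0 Q (by
    intro π h1 h2 c c' hc hc' hq
    refine inner_inv hk hC2 h1 h2 (Y := fun i d j => c (y (i, d) j)) (Y' := fun i d j => c' (y (i, d) j)) ?_ ?_ hq
    · intro i d j h1 h2 h3
      exact hc _ (hm0 _ _ ((hPm _).2 ⟨i.2, h1, h2⟩) h3)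
    · intro i d j h1 h2 h3
      exact hc' _ (hm0 _ _ ((hPm _).2 ⟨i.2, h1, h2⟩) h3))
  have e0 : L0 = [] ++ Pm.flatMap (fun p => (List.range 3).map (y p)) := by
    simp only [L0, List.product, List.map_flatMap, List.map_map, List.nil_append]
    rfl
  have h0' := h0
  rw [e0] at h0'
  have h1 := Rlz.collapses _ z (fun p => Set.Icc 1 3 ∪ {p.2}) Pm ?_ (hPn.map hzi) h0' ?_
  rotate_left
  · intro p hp
    rw [hPm] at hp
    refine ⟨Set.subset_union_left, Set.union_subset (Set.Icc_subset_Icc_right hk) ?_⟩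
    simpa using hp.2
  · intro p hp h
    rw [← e0] at h
    obtain ⟨p', _, j, _, h⟩ := hm0' _ h
    simp [y, z] at h
  rw [← e0] at h1
  have e1 : [] ++ Pm.map z = [] ++ (List.range m).flatMap (fun i => (List.range' 1 k).map (fun d => z (i, d))) := by
    simp only [Pm, List.product, List.map_flatMap, List.map_map, List.nil_append]
    rfl
  rw [e1] at h1
  have h2 := Rlz.collapses _ x (fun _ => Set.Icc 1 k) (List.range m) ?_ (List.nodup_range.map hxi) h1 ?_
  rotate_left
  · intro p hp
    exact ⟨Set.Icc_subset_Icc_right hk, le_rfl⟩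
  · rintro p hp (h | h)
    · obtain ⟨p', _, j, _, h⟩ := hm0' _ h
      simp [y, x] at h
    · obtain ⟨p', _, h⟩ := List.mem_map.1 h
      simp [z, x] at h
  refine h2.reindex (fun i : Fin m => x i) ?_ ?_ (fun _ _ => Set.mem_univ _) ?_
  · rw [List.nil_append, ← List.map_coe_finRange_eq_range, List.map_map]
    rfl
  · intro i _
    exact Or.inr (List.mem_map.2 ⟨i, List.mem_range.2 i.2, rfl⟩)
  · intro f
    constructor
    · intro hf
      have hf1 := hC1 f hf
      let F : ℕ → ℕ := fun i => if h : i < m then f ⟨i, h⟩ else 1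
      have hF : ∀ i : Fin m, F i = f i := fun i => by simp [F]
      have hF1 : ∀ i, 1 ≤ F i ∧ F i ≤ k := by
        intro i
        by_cases h : i < m
        · simpa [F, h] using hf1 ⟨i, h⟩
        · simp only [F, dif_neg h]; omega
      let c0 : ℕ × (ℕ × ℕ) × ℕ → ℕ := fun q =>
        if q.1 = 0 then Pt (F q.2.1.1) q.2.1.2 q.2.2 else if q.1 = 1 then Zt (F q.2.1.1) q.2.1.2 else F q.2.1.1
      have cy : ∀ i d j, c0 (y (i, d) j) = Pt (F i) d j := fun i d j => by simp [c0, y]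
      have cz : ∀ i d, c0 (z (i, d)) = Zt (F i) d := fun i d => by simp [c0, z]
      have cx : ∀ i, c0 (x i) = F i := fun i => by simp [c0, x]
      refine ⟨c0, ⟨⟨⟨?_, ?_⟩, ?_⟩, ?_⟩, ?_⟩
      · intro w hw
        obtain ⟨⟨i, d⟩, hp, j, hj, rfl⟩ := hm0' w hw
        rw [cy]
        exact Pt_mem (hF1 i).1 hj
      · intro f' hf' hA
        have : f' = f := by
          funext i
          have h := hA i
          simp only [cy] at h
          have h3 := hf' i
          rw [Finset.mem_Icc] at h3
          rw [← hF]
          exact Allow_Pt h3.1 h3.2 h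
        rwa [this]
      · rintro ⟨i, d⟩ hp
        rw [cz]
        have := Zt_spec (d := d) (hF1 i).1
        refine ⟨this.1, ?_⟩
        intro w hw
        obtain ⟨j, hj, rfl⟩ := List.mem_map.1 hw
        rw [cy]
        exact this.2.1 j (List.mem_range.1 hj)
      · intro i hi
        rw [cx]
        refine ⟨hF1 i, ?_⟩
        intro w hw
        obtain ⟨d, hd, rfl⟩ := List.mem_map.1 hw
        rw [cz]
        exact (Zt_spec (hF1 i).1).2.2
      · intro i _
        rw [cx, hF]
    · rintro ⟨c0, ⟨⟨⟨_, hq⟩, hz⟩, hx⟩, hf⟩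
      apply hq f
      · intro i
        have := (hx i (List.mem_range.2 i.2)).1
        rw [hf i (Set.mem_univ _)] at this
        simpa using this
      · intro i d hd hdk
        have h1 := hz (i, d) ((hPm _).2 ⟨i.2, hd, hdk⟩)
        have h2 := (hx i (List.mem_range.2 i.2)).2 (z (i, d)) 
          (List.mem_map.2 ⟨d, by rw [List.mem_range'_1]; omega, rfl⟩)
        rw [hf i (Set.mem_univ _)] at h2
        refine ⟨c0 (z (i, d)), h1.1, ?_, h2⟩
        intro j hj
        exact h1.2 _ (List.mem_map.2 ⟨j, List.mem_range.2 hj, rfl⟩)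


theorem conn_preimage {V W : Type} {G : SimpleGraph V} {G' : SimpleGraph W} (φ : V → W)
    (hadj : ∀ u v, G'.Adj (φ u) (φ v) → G.Adj u v) (hφ : Function.Injective φ) {s : Set W} (hs : s ⊆ Set.range φ)
    (h : (G'.induce s).Connected) : (G.induce (φ ⁻¹' s)).Connected := by
  choose f hf using fun x : s => hs x.2
  let F : G'.induce s →g G.induce (φ ⁻¹' s) :=
    { toFun := fun x => ⟨f x, by rw [Set.mem_preimage, hf]; exact x.2⟩
      map_rel' := by
        intro a b hab
        apply hadj
        change G'.Adj (φ (f a)) (φ (f b))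
        rw [hf, hf]
        exact hab }
  refine h.map F ?_
  rintro ⟨v, hv⟩
  refine ⟨⟨φ v, hv⟩, ?_⟩
  apply Subtype.ext
  exact hφ (hf ⟨φ v, hv⟩)

theorem good_sets {V W : Type} {n r : ℕ} (φ : V → W) (α : Fin r → W) (hA : ∀ w, w ∈ Set.range φ ∨ w ∈ Set.range α)
    (μ : Fin (n + r) → Set W) (hd : ∀ i j, i ≠ j → Disjoint (μ i) (μ j)) :
    ∃ τ : Fin n → Fin (n + r), Function.Injective τ ∧ ∀ i, μ (τ i) ⊆ Set.range φ := by
  classical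
  let good : Finset (Fin (n + r)) := Finset.univ.filter fun i => μ i ⊆ Set.range φ
  have hbad : ∀ i : {i // i ∈ goodᶜ}, ∃ a : Fin r, α a ∈ μ i := by
    rintro ⟨i, hi⟩
    simp only [good, Finset.mem_compl, Finset.mem_filter, Finset.mem_univ, true_and, Set.not_subset] at hi
    obtain ⟨w, hw, hw'⟩ := hi
    rcases hA w with h | ⟨a, rfl⟩
    · exact absurd h hw'
    · exact ⟨a, hw⟩
  choose b hb using hbad
  have hbi : Function.Injective b := by
    intro i j hij
    by_contra hne
    have := hd i j (fun h => hne (Subtype.ext h))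
    exact Set.disjoint_left.1 this (hb i) (hij ▸ hb j)
  have hc := Fintype.card_le_of_injective b hbi
  rw [Fintype.card_coe, Finset.card_compl, Fintype.card_fin, Fintype.card_fin] at hc
  have hg : n ≤ good.card := by omega
  refine ⟨fun i => good.orderEmbOfFin rfl (Fin.castLE hg i), ?_, ?_⟩
  · intro i j hij
    have := (good.orderEmbOfFin rfl).injective hij
    exact Fin.castLE_injective hg this
  · intro i
    have := good.orderEmbOfFin_mem rfl (Fin.castLE hg i)
    exact (Finset.mem_filter.1 this).2

theorem minor_del {V W : Type} {n r : ℕ} {G : SimpleGraph V} {G' : SimpleGraph W} (φ : V → W) (α : Fin r → W)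
    (hA : ∀ w, w ∈ Set.range φ ∨ w ∈ Set.range α) (hadj : ∀ u v, G'.Adj (φ u) (φ v) → G.Adj u v)
    (hφ : Function.Injective φ) (h : HasCliqueMinor G' (n + r)) : HasCliqueMinor G n := by
  obtain ⟨μ, h1, h2, h3⟩ := h
  obtain ⟨τ, t1, t2⟩ := good_sets φ α hA μ h2
  refine ⟨fun i => φ ⁻¹' μ (τ i), ?_, ?_, ?_⟩
  · intro i
    obtain ⟨⟨w, hw⟩, hc⟩ := h1 (τ i)
    obtain ⟨v, rfl⟩ := t2 i hw
    exact ⟨⟨v, hw⟩, conn_preimage φ hadj hφ (t2 i) hc⟩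
  · intro i j hij
    exact (h2 _ _ (fun h => hij (t1 h))).preimage φ
  · intro i j hij
    obtain ⟨a, ha, b, hb, hab⟩ := h3 _ _ (fun h => hij (t1 h))
    obtain ⟨u, rfl⟩ := t2 i ha
    obtain ⟨v, rfl⟩ := t2 j hb
    exact ⟨u, ha, v, hb, hadj _ _ hab⟩

theorem rooted_del {V W : Type} {n r : ℕ} {G : SimpleGraph V} {G' : SimpleGraph W} (φ : V → W) (α : Fin r → W)
    (hA : ∀ w, w ∈ Set.range φ ∨ w ∈ Set.range α) (hadj : ∀ u v, G'.Adj (φ u) (φ v) → G.Adj u v)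
    (hφ : Function.Injective φ) {X : Set W} (h : HasRootedCliqueMinor G' X (n + r)) :
    HasRootedCliqueMinor G (φ ⁻¹' X) n := by
  obtain ⟨μ, h1, h2, h3⟩ := h
  obtain ⟨τ, t1, t2⟩ := good_sets φ α hA μ h2
  refine ⟨fun i => φ ⁻¹' μ (τ i), ?_, ?_, ?_⟩
  · intro i
    obtain ⟨⟨w, hw, hw'⟩, hc⟩ := h1 (τ i)
    obtain ⟨v, rfl⟩ := t2 i hw
    exact ⟨⟨v, hw, hw'⟩, conn_preimage φ hadj hφ (t2 i) hc⟩
  · intro i j hij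
    exact (h2 _ _ (fun h => hij (t1 h))).preimage φ
  · intro i j hij
    obtain ⟨a, ha, b, hb, hab⟩ := h3 _ _ (fun h => hij (t1 h))
    obtain ⟨u, rfl⟩ := t2 i ha
    obtain ⟨v, rfl⟩ := t2 j hb
    exact ⟨u, ha, v, hb, hadj _ _ hab⟩

/-- The graph `G` together with a clique of new vertices, realizing the lists `S`. -/
def listGraph {V : Type} (G : SimpleGraph V) (S : V → Set ℕ) (r : ℕ) : SimpleGraph (V ⊕ Fin r) where
  Adj
    | Sum.inl u, Sum.inl v => G.Adj u v
    | Sum.inl u, Sum.inr j => (j : ℕ) + 4 ∉ S u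
    | Sum.inr j, Sum.inl u => (j : ℕ) + 4 ∉ S u
    | Sum.inr i, Sum.inr j => i ≠ j
  symm := ⟨by
    rintro (u | i) (v | j) h
    · exact G.adj_symm h
    · exact h
    · exact h
    · exact Ne.symm h⟩
  loopless := ⟨by
    rintro (u | i) h
    · exact G.loopless.irrefl u h
    · exact h rfl⟩

theorem exists_recolor {k r : ℕ} (u : Fin r → ℕ) (hu : Function.Injective u) (huk : ∀ j, u j ∈ Set.Icc 1 k)
    (v : Fin r → ℕ) (hv : Function.Injective v) (hvk : ∀ j, v j ∈ Set.Icc 1 k) :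
    ∃ s s' : ℕ → ℕ, Set.BijOn s (Set.Icc 1 k) (Set.Icc 1 k) ∧ Set.BijOn s' (Set.Icc 1 k) (Set.Icc 1 k) ∧
      (∀ n, s' (s n) = n) ∧ ∀ j, s (u j) = v j := by
  classical
  let u' : Fin r → Set.Icc 1 k := fun j => ⟨u j, huk j⟩
  let v' : Fin r → Set.Icc 1 k := fun j => ⟨v j, hvk j⟩
  have hu' : Function.Injective u' := fun i j h => hu (congrArg Subtype.val h)
  have hv' : Function.Injective v' := fun i j h => hv (congrArg Subtype.val h)
  let e : {x // x ∈ Set.range u'} ≃ {x // x ∈ Set.range v'} :=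
    (Equiv.ofInjective u' hu').symm.trans (Equiv.ofInjective v' hv')
  let σ : Equiv.Perm (Set.Icc 1 k) := e.extendSubtype
  have hσ : ∀ j, σ (u' j) = v' j := by
    intro j
    have := e.extendSubtype_apply_of_mem (u' j) ⟨j, rfl⟩
    rw [this]
    have h2 : (Equiv.ofInjective u' hu').symm ⟨u' j, ⟨j, rfl⟩⟩ = j := Equiv.ofInjective_symm_apply hu' j
    change ((Equiv.ofInjective v' hv') ((Equiv.ofInjective u' hu').symm ⟨u' j, ⟨j, rfl⟩⟩) : Set.Icc 1 k) = v' j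
    rw [h2]
    rfl
  let F : Equiv.Perm (Set.Icc 1 k) → ℕ → ℕ := fun σ n => if h : n ∈ Set.Icc 1 k then (σ ⟨n, h⟩ : ℕ) else n
  have hF1 : ∀ σ n, n ∈ Set.Icc 1 k → F σ n ∈ Set.Icc 1 k := by
    intro σ n hn
    simp only [F, dif_pos hn]
    exact (σ ⟨n, hn⟩).2
  have hF2 : ∀ σ τ : Equiv.Perm (Set.Icc 1 k), (∀ x, τ (σ x) = x) → ∀ n, F τ (F σ n) = n := by
    intro σ τ h n
    by_cases hn : n ∈ Set.Icc 1 k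
    · have := hF1 σ n hn
      simp only [F, dif_pos hn, Subtype.coe_prop, dif_pos, Subtype.coe_eta, h]
    · simp only [F, dif_neg hn]
  have hF3 : ∀ σ τ : Equiv.Perm (Set.Icc 1 k), (∀ x, τ (σ x) = x) → (∀ x, σ (τ x) = x) →
      Set.BijOn (F σ) (Set.Icc 1 k) (Set.Icc 1 k) := by
    intro σ τ h h'
    refine ⟨hF1 σ, ?_, fun n hn => ⟨F τ n, hF1 τ n hn, hF2 τ σ h' n⟩⟩
    intro a _ b _ hab
    rw [← hF2 σ τ h a, hab, hF2 σ τ h b]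
  refine ⟨F σ, F σ.symm, hF3 σ σ.symm (by simp) (by simp), hF3 σ.symm σ (by simp) (by simp), hF2 _ _ (by simp), ?_⟩
  intro j
  simp only [F, dif_pos (huk j)]
  exact congrArg Subtype.val (hσ j)

theorem listGraph_color {k m : ℕ} (hk : 3 ≤ k) (C : Set (Fin m → ℕ))
    (hC2 : ∀ π : ℕ → ℕ, Set.BijOn π (Set.Icc 1 k) (Set.Icc 1 k) →
      ∀ f ∈ C, (fun i => π (f i)) ∈ C) {V : Type} (G : SimpleGraph V) (S : V → Set ℕ) (e : Fin m → V)
    (hS : ∀ v, Set.Icc 1 3 ⊆ S v ∧ S v ⊆ Set.Icc 1 k)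
    (hc : ∀ c, c ∈ C ↔ ∃ g : V → ℕ, (∀ v, g v ∈ S v) ∧ (∀ x y, G.Adj x y → g x ≠ g y) ∧ ∀ y, g (e y) = c y)
    (f : Fin m → ℕ) :
    (∃ c, IsProperKColoring (listGraph G S (k - 3)) k c ∧ ∀ i, c (Sum.inl (e i)) = f i) ↔ f ∈ C := by
  constructor
  · rintro ⟨c, ⟨hc1, hc2⟩, hcf⟩
    have hc1' : ∀ v, c v ∈ Set.Icc 1 k := fun v => by simpa using hc1 v
    obtain ⟨s, s', hs, hs', hss, hsu⟩ := exists_recolor (k := k) (fun j : Fin (k - 3) => c (Sum.inr j))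
      (by
        intro i j hij
        by_contra hne
        exact hc2 (x := Sum.inr i) (y := Sum.inr j) hne hij) (fun j => hc1' _) (fun j : Fin (k - 3) => (j : ℕ) + 4)
      (by intro i j hij; simp only at hij; omega) (by intro j; have := j.2; simp only [Set.mem_Icc]; omega)
    have h1 : (fun i => s (f i)) ∈ C := by
      rw [hc]
      refine ⟨fun v => s (c (Sum.inl v)), ?_, ?_, ?_⟩
      · intro v
        have hv := hs.1 (hc1' (Sum.inl v))
        rw [Set.mem_Icc] at hv
        by_contra hn
        have h4 : ¬ s (c (Sum.inl v)) ≤ 3 := fun h => hn ((hS v).1 ⟨hv.1, h⟩)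
        let j : Fin (k - 3) := ⟨s (c (Sum.inl v)) - 4, by omega⟩
        have hj : (j : ℕ) + 4 = s (c (Sum.inl v)) := by simp only [j]; omega
        have hadj : (listGraph G S (k - 3)).Adj (Sum.inl v) (Sum.inr j) := by
          change (j : ℕ) + 4 ∉ S v
          rw [hj]; exact hn
        apply hc2 hadj
        rw [← hss (c (Sum.inl v)), ← hss (c (Sum.inr j)), hsu, hj]
      · intro x y hxy h
        have hadj : (listGraph G S (k - 3)).Adj (Sum.inl x) (Sum.inl y) := hxy
        apply hc2 hadj
        have h : s (c (Sum.inl x)) = s (c (Sum.inl y)) := h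
        rw [← hss (c (Sum.inl x)), h, hss]
      · intro y
        simp only [hcf]
    have := hC2 s' hs' _ h1
    simpa only [hss] using this
  · intro hf
    obtain ⟨g, h1, h2, h3⟩ := (hc f).1 hf
    refine ⟨Sum.elim g (fun j => (j : ℕ) + 4), ⟨?_, ?_⟩, h3⟩
    · rintro (v | j)
      · simpa using (hS v).2 (h1 v)
      · have := j.2
        simp only [Sum.elim_inr, Finset.mem_Icc]; omega
    · rintro (x | i) (y | j) hxy
      · exact h2 x y hxy
      · have h : (j : ℕ) + 4 ∉ S x := hxy
        intro he
        apply h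
        simp only [Sum.elim_inl, Sum.elim_inr] at he
        rw [← he]; exact h1 x
      · have h : (i : ℕ) + 4 ∉ S y := hxy
        intro he
        apply h
        simp only [Sum.elim_inl, Sum.elim_inr] at he
        rw [he]; exact h1 y
      · have h : i ≠ j := hxy
        intro he
        simp only [Sum.elim_inr] at he
        apply h
        omega

theorem rooted_realization (k m : ℕ) (hk : 3 ≤ k) (C : Set (Fin m → ℕ))
    (hC1 : ∀ f ∈ C, ∀ i, f i ∈ Finset.Icc 1 k)
    (hC2 : ∀ π : ℕ → ℕ, Set.BijOn π (Set.Icc 1 k) (Set.Icc 1 k) →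
      ∀ f ∈ C, (fun i => π (f i)) ∈ C) :
    ∃ (N : ℕ) (G : SimpleGraph (Fin m ⊕ Fin N)),
      ¬ HasRootedCliqueMinor G (Set.range Sum.inl) (k + 1) ∧
      ¬ HasCliqueMinor G (k + 2) ∧
      ∀ f : Fin m → ℕ, (∀ i, f i ∈ Finset.Icc 1 k) →
        ((∃ c : (Fin m ⊕ Fin N) → ℕ, IsProperKColoring G k c ∧
          ∀ i : Fin m, c (Sum.inl i) = f i) ↔ f ∈ C) := by
  classical
  obtain ⟨V, _, G, S, a, w, e, hD, hS, _, hP⟩ := phase2 hk hC1 hC2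
  have he : Function.Injective e := by
    have := hD.nodup
    rw [List.nodup_cons, List.nodup_append] at this
    have h2 := List.inj_on_of_nodup_map this.2.1
    intro i j hij
    exact h2 (List.mem_finRange i) (List.mem_finRange j) hij
  let q : Fin m → V ⊕ Fin (k - 3) := fun i => Sum.inl (e i)
  have hq : Function.Injective q := fun i j h => he (Sum.inl_injective h)
  let N := Fintype.card ((Set.range q)ᶜ : Set (V ⊕ Fin (k - 3)))
  let ψ : Fin m ⊕ Fin N ≃ V ⊕ Fin (k - 3) :=
    (Equiv.sumCongr (Equiv.ofInjective q hq) (Fintype.equivFin ((Set.range q)ᶜ : Set (V ⊕ Fin (k - 3)))).symm).trans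
      (Equiv.Set.sumCompl (Set.range q))
  have hψ : ∀ i, ψ (Sum.inl i) = Sum.inl (e i) := by
    intro i
    simp [ψ, q]
  let φ : V → Fin m ⊕ Fin N := fun v => ψ.symm (Sum.inl v)
  let α : Fin (k - 3) → Fin m ⊕ Fin N := fun v => ψ.symm (Sum.inr v)
  have hA : ∀ w, w ∈ Set.range φ ∨ w ∈ Set.range α := by
    intro w
    rcases h : ψ w with v | j
    · left; exact ⟨v, by simp only [φ, ← h, Equiv.symm_apply_apply]⟩
    · right; exact ⟨j, by simp only [α, ← h, Equiv.symm_apply_apply]⟩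
  have hφ : Function.Injective φ := fun u v h => Sum.inl_injective (ψ.symm.injective h)
  have hadj : ∀ u v, ((listGraph G S (k - 3)).comap ψ).Adj (φ u) (φ v) → G.Adj u v := by
    intro u v h
    rw [SimpleGraph.comap_adj] at h
    simp only [φ, Equiv.apply_symm_apply] at h
    exact h
  refine ⟨N, (listGraph G S (k - 3)).comap ψ, ?_, ?_, ?_⟩
  · intro h
    rw [show k + 1 = 4 + (k - 3) by omega] at h
    have h1 := rooted_del φ α hA hadj hφ h
    have e1 : φ ⁻¹' (Set.range Sum.inl) = {v | v ∈ (List.finRange m).map e} := by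
      ext v
      change (∃ i, Sum.inl i = φ v) ↔ v ∈ (List.finRange m).map e
      simp only [List.mem_map, List.mem_finRange, true_and]
      refine exists_congr fun i => ?_
      simp only [φ]
      rw [Equiv.eq_symm_apply, hψ, Sum.inl.injEq]
    rw [e1] at h1
    exact hD.no_rooted h1
  · intro h
    rw [show k + 2 = 5 + (k - 3) by omega] at h
    exact hD.no_K5 (minor_del φ α hA hadj hφ h)
  · intro f _
    rw [← listGraph_color hk C hC2 G S e hS (by simpa using hP) f]
    constructor
    · rintro ⟨c, ⟨h1, h2⟩, h3⟩
      refine ⟨fun x => c (ψ.symm x), ⟨fun v => h1 _, ?_⟩, ?_⟩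
      · intro x y hxy
        apply h2
        rw [SimpleGraph.comap_adj]
        simpa using hxy
      · intro i
        simp only [← hψ, Equiv.symm_apply_apply, h3]
    · rintro ⟨c, ⟨h1, h2⟩, h3⟩
      refine ⟨fun x => c (ψ x), ⟨fun v => h1 _, ?_⟩, ?_⟩
      · intro x y hxy
        exact h2 hxy
      · intro i
        simp only [hψ, h3]
end

section
/- Let G₀ be a planar graph with a plane embedding in which all vertices of a set X ⊆ V(G₀) lie on the boundary of the outer face. Then G₀ is X-rooted-K₄-minor-free. -/
open Set in
/-- `G` is planar: it has a drawing in the plane with vertices at distinct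
points and edges as non-crossing arcs.  For each edge an arc (a continuous
curve, injective on `[0,1]`) joins the endpoints; the interior of an arc
avoids all vertex points, and arcs of distinct edges meet at most in common
endpoints. -/
def IsPlanar {V : Type*} (G : SimpleGraph V) : Prop :=
  ∃ (pos : V → ℝ × ℝ) (arc : V → V → ℝ → ℝ × ℝ),
    Function.Injective pos ∧
    (∀ u v, G.Adj u v → ContinuousOn (arc u v) (Icc 0 1) ∧
      InjOn (arc u v) (Icc 0 1) ∧ arc u v 0 = pos u ∧ arc u v 1 = pos v) ∧
    (∀ u v, G.Adj u v → ∀ w : V, pos w ∉ arc u v '' Ioo 0 1) ∧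
    (∀ u v a b, G.Adj u v → G.Adj a b → s(u, v) ≠ s(a, b) →
      ∀ p ∈ arc u v '' Ioo 0 1, p ∉ arc a b '' Icc 0 1)

/-- The graph obtained from `G` by adding one new vertex (`none`) adjacent
exactly to the vertices in `S`. -/
def addVertex {V : Type*} (G : SimpleGraph V) (S : Set V) : SimpleGraph (Option V) :=
  SimpleGraph.fromRel (fun x y =>
    match x, y with
    | some a, some b => G.Adj a b
    | none, some a => a ∈ S
    | _, _ => False)

/-- Continuous logarithms exist on simply connected spaces. -/
lemma exists_cont_log {A : Type*} [TopologicalSpace A] [SimplyConnectedSpace A]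
    [LocallyPathConnectedSpace A] (f : A → ℂ) (hf : Continuous f) (h0 : ∀ a, f a ≠ 0) :
    ∃ L : A → ℂ, Continuous L ∧ ∀ a, Complex.exp (L a) = f a := by
  obtain ⟨a₀⟩ : Nonempty A := inferInstance
  obtain ⟨F, ⟨-, hF⟩, -⟩ := Complex.isCoveringMap_exp.existsUnique_continuousMap_lifts
    (⟨fun a => ⟨f a, h0 a⟩, by fun_prop⟩ : C(A, {z : ℂ // z ≠ 0})) a₀ (Complex.log (f a₀))
    (Subtype.ext (Complex.exp_log (h0 a₀)))
  exact ⟨F, F.continuous, fun a => congrArg Subtype.val (congrFun hF a)⟩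

/-- The increment of a continuous logarithm does not depend on the choice, and does not change
when the function is multiplied by a constant. -/
lemma log_increment_eq (L M : ℝ → ℂ) (hL : Continuous L) (hM : Continuous M) (c : ℂ)
    (h : ∀ t, Complex.exp (L t) = c * Complex.exp (M t)) : L 1 - L 0 = M 1 - M 0 := by
  have hc : c = Complex.exp (L 0 - M 0) := by
    rw [Complex.exp_sub, h 0]
    field_simp
  have key : L = fun t => M t + (L 0 - M 0) := by
    refine Complex.isCoveringMap_exp.eq_of_comp_eq hL (by fun_prop) ?_ 0 (by ring)
    ext t
    simp only [Function.comp]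
    rw [h t, Complex.exp_add, ← hc, mul_comm]
  have h1 := congrFun key 1
  rw [h1]; ring

/-- Zero total increment along the boundary of the square. -/
lemma square_increment (f g : ℝ → ℂ) (hf : Continuous f) (hg : Continuous g)
    (hfg : ∀ s t, f s ≠ g t) (L0 L1 K0 K1 : ℝ → ℂ)
    (cL0 : Continuous L0) (cL1 : Continuous L1) (cK0 : Continuous K0) (cK1 : Continuous K1)
    (hL0 : ∀ t, Complex.exp (L0 t) = g t - f 0) (hL1 : ∀ t, Complex.exp (L1 t) = g t - f 1)
    (hK0 : ∀ t, Complex.exp (K0 t) = f t - g 0) (hK1 : ∀ t, Complex.exp (K1 t) = f t - g 1) :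
    (L0 1 - L0 0) - (L1 1 - L1 0) + (K1 1 - K1 0) - (K0 1 - K0 0) = 0 := by
  obtain ⟨M, cM, hM⟩ := exists_cont_log (fun x : ℝ × ℝ => g x.2 - f x.1) (by fun_prop)
    (fun x => sub_ne_zero.2 (hfg x.1 x.2).symm)
  have e1 := log_increment_eq L0 (fun t => M (0, t)) cL0 (by fun_prop) 1
    (fun t => by rw [hM, hL0, one_mul])
  have e2 := log_increment_eq L1 (fun t => M (1, t)) cL1 (by fun_prop) 1
    (fun t => by rw [hM, hL1, one_mul])
  have e3 := log_increment_eq K0 (fun t => M (t, 0)) cK0 (by fun_prop) (-1)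
    (fun t => by rw [hM, hK0]; ring)
  have e4 := log_increment_eq K1 (fun t => M (t, 1)) cK1 (by fun_prop) (-1)
    (fun t => by rw [hM, hK1]; ring)
  rw [e1, e2, e3, e4]
  ring

/-- Van Kampen: any continuous map of `K₅` to the plane has two disjoint edges whose images
meet. -/
lemma vanKampen_K5 (p : Fin 5 → ℂ) (γ : Fin 5 → Fin 5 → ℝ → ℂ)
    (hc : ∀ i j, i ≠ j → Continuous (γ i j)) (h0 : ∀ i j, i ≠ j → γ i j 0 = p i)
    (h1 : ∀ i j, i ≠ j → γ i j 1 = p j)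
    (hd : ∀ i j k l, i ≠ j → k ≠ l → i ≠ k → i ≠ l → j ≠ k → j ≠ l →
      ∀ s t, γ i j s ≠ γ k l t) : False := by
  have hp : ∀ i k l, i ≠ k → i ≠ l → k ≠ l → ∀ t, γ k l t ≠ p i := by
    intro i k l hik hil hkl t
    obtain ⟨j, hj⟩ : ∃ j : Fin 5, j ≠ i ∧ j ≠ k ∧ j ≠ l := by
      revert i k l; decide
    rw [← h0 i j hj.1.symm]
    exact (hd i j k l hj.1.symm hkl hik hil hj.2.1 hj.2.2 0 t).symm
  have hpp : ∀ i k, i ≠ k → p i ≠ p k := by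
    intro i k hik
    obtain ⟨j, hj⟩ : ∃ j : Fin 5, j ≠ i ∧ j ≠ k := by
      revert i k; decide
    rw [← h0 k j hj.2.symm]
    exact (hp i k j hik hj.1.symm hj.2.symm 0).symm
  have hL : ∀ i k l, ∃ L : ℝ → ℂ, i ≠ k → i ≠ l → k ≠ l →
      Continuous L ∧ ∀ t, Complex.exp (L t) = γ k l t - p i := by
    intro i k l
    by_cases h : i ≠ k ∧ i ≠ l ∧ k ≠ l
    · have := hc k l h.2.2
      obtain ⟨L, h1, h2⟩ := exists_cont_log (fun t => γ k l t - p i) (by fun_prop)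
        (fun t => sub_ne_zero.2 (hp i k l h.1 h.2.1 h.2.2 t))
      exact ⟨L, fun _ _ _ => ⟨h1, h2⟩⟩
    · exact ⟨0, fun a b c => absurd ⟨a, b, c⟩ h⟩
  choose L hL using hL
  obtain ⟨b, hb⟩ : ∃ b : Fin 5 → Fin 5 → ℤ, b = fun i k => if i < k then -1 else 1 := ⟨_, rfl⟩
  obtain ⟨w, hw, hwb⟩ : ∃ w : Fin 5 → Fin 5 → ℂ,
      (∀ i k, i ≠ k → Complex.exp (w i k) = p k - p i) ∧
      ∀ i k, i ≠ k → w i k - w k i = b i k * (Real.pi * Complex.I) := by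
    refine ⟨fun i k => if i < k then Complex.log (p k - p i)
      else Complex.log (p i - p k) + Real.pi * Complex.I, ?_, ?_⟩
    · intro i k hik
      have ha := sub_ne_zero.2 (hpp i k hik)
      have hb := sub_ne_zero.2 (hpp k i hik.symm)
      dsimp only
      split_ifs
      · rw [Complex.exp_log hb]
      · rw [Complex.exp_add, Complex.exp_log ha, Complex.exp_pi_mul_I]; ring
    · intro i k hik
      rcases lt_or_gt_of_ne hik with h | h
      · simp [hb, h, h.not_gt]
      · simp [hb, h, h.not_gt]
  have hn : ∀ i k l, ∃ n : ℤ, i ≠ k → i ≠ l → k ≠ l →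
      L i k l 1 - L i k l 0 = w i l - w i k + n * (2 * Real.pi * Complex.I) := by
    intro i k l
    by_cases h : i ≠ k ∧ i ≠ l ∧ k ≠ l
    · obtain ⟨a, b, c⟩ := h
      have e : Complex.exp (L i k l 1 - L i k l 0) = Complex.exp (w i l - w i k) := by
        rw [Complex.exp_sub, Complex.exp_sub, (hL i k l a b c).2, (hL i k l a b c).2,
          hw i l b, hw i k a, h0 k l c, h1 k l c]
      obtain ⟨n, hn⟩ := Complex.exp_eq_exp_iff_exists_int.1 e
      exact ⟨n, fun _ _ _ => hn⟩
    · exact ⟨0, fun a b c => absurd ⟨a, b, c⟩ h⟩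
  choose n hn using hn
  have E : ∀ i j k l, i ≠ j → k ≠ l → i ≠ k → i ≠ l → j ≠ k → j ≠ l →
      2 * (n i k l - n j k l + n l i j - n k i j) + (b i l - b i k - b j l + b j k) = 0 := by
    intro i j k l hij hkl hik hil hjk hjl
    have S := square_increment (γ i j) (γ k l) (hc i j hij) (hc k l hkl)
      (hd i j k l hij hkl hik hil hjk hjl)
      (L i k l) (L j k l) (L k i j) (L l i j)
      (hL i k l hik hil hkl).1 (hL j k l hjk hjl hkl).1
      (hL k i j hik.symm hjk.symm hij).1 (hL l i j hil.symm hjl.symm hij).1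
      (by rw [h0 i j hij]; exact (hL i k l hik hil hkl).2)
      (by rw [h1 i j hij]; exact (hL j k l hjk hjl hkl).2)
      (by rw [h0 k l hkl]; exact (hL k i j hik.symm hjk.symm hij).2)
      (by rw [h1 k l hkl]; exact (hL l i j hil.symm hjl.symm hij).2)
    rw [hn i k l hik hil hkl, hn j k l hjk hjl hkl, hn k i j hik.symm hjk.symm hij,
      hn l i j hil.symm hjl.symm hij] at S
    have hne : (Real.pi : ℂ) * Complex.I ≠ 0 := by simp [Real.pi_ne_zero]
    have T : ((2 * (n i k l - n j k l + n l i j - n k i j) +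
        (b i l - b i k - b j l + b j k) : ℤ) : ℂ) * (Real.pi * Complex.I) = 0 := by
      push_cast
      linear_combination S - hwb i l hil + hwb i k hik + hwb j l hjl - hwb j k hjk
    exact_mod_cast (mul_eq_zero.1 T).resolve_right hne
  have F : ∀ i j k l : Fin 5, (i ≠ j ∧ k ≠ l ∧ i ≠ k ∧ i ≠ l ∧ j ≠ k ∧ j ≠ l) →
      ∀ c, b i l - b i k - b j l + b j k = 2 * c →
      n i k l - n j k l + n l i j - n k i j + c = 0 := by
    intro i j k l h c hc
    have := E i j k l h.1 h.2.1 h.2.2.1 h.2.2.2.1 h.2.2.2.2.1 h.2.2.2.2.2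
    omega
  subst hb
  have f1 := F 0 1 2 3 (by decide) 0 (by decide)
  have f2 := F 0 2 1 3 (by decide) 1 (by decide)
  have f3 := F 0 3 1 2 (by decide) 0 (by decide)
  have f4 := F 0 1 2 4 (by decide) 0 (by decide)
  have f5 := F 0 2 1 4 (by decide) 1 (by decide)
  have f6 := F 0 4 1 2 (by decide) 0 (by decide)
  have f7 := F 0 1 3 4 (by decide) 0 (by decide)
  have f8 := F 0 3 1 4 (by decide) 1 (by decide)
  have f9 := F 0 4 1 3 (by decide) 0 (by decide)
  have f10 := F 0 2 3 4 (by decide) 0 (by decide)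
  have f11 := F 0 3 2 4 (by decide) 1 (by decide)
  have f12 := F 0 4 2 3 (by decide) 0 (by decide)
  have f13 := F 1 2 3 4 (by decide) 0 (by decide)
  have f14 := F 1 3 2 4 (by decide) 1 (by decide)
  have f15 := F 1 4 2 3 (by decide) 0 (by decide)
  clear F E hn hL hwb
  omega

/-- A planar graph has no `K₅` minor. -/
lemma planar_no_K5_minor {W : Type*} (G : SimpleGraph W) (hG : IsPlanar G)
    (ν : Fin 5 → Set W) (hne : ∀ i, (ν i).Nonempty)
    (hconn : ∀ i, ∀ a ∈ ν i, ∀ b ∈ ν i,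
      Relation.ReflTransGen (fun u v => G.Adj u v ∧ u ∈ ν i ∧ v ∈ ν i) a b)
    (hdisj : ∀ i j, i ≠ j → Disjoint (ν i) (ν j))
    (hadj : ∀ i j, i ≠ j → ∃ a ∈ ν i, ∃ b ∈ ν j, G.Adj a b) : False := by
  obtain ⟨pos, arc, hinj, harc, hint, hcross⟩ := hG
  -- the drawing of the subgraph induced on a vertex set
  let D : Set W → Set (ℝ × ℝ) := fun A =>
    {q | (∃ a ∈ A, q = pos a) ∨
      ∃ u ∈ A, ∃ v ∈ A, G.Adj u v ∧ q ∈ arc u v '' Set.Ioo 0 1}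
  have hIcc : ∀ u v, G.Adj u v → ∀ t ∈ Set.Icc (0 : ℝ) 1,
      arc u v t = pos u ∨ arc u v t = pos v ∨ arc u v t ∈ arc u v '' Set.Ioo 0 1 := by
    intro u v h t ht
    rcases ht.1.eq_or_lt with h0 | h0
    · left; rw [← h0, (harc u v h).2.2.1]
    rcases ht.2.eq_or_lt with h1 | h1
    · right; left; rw [h1, (harc u v h).2.2.2]
    · exact Or.inr (Or.inr ⟨t, ⟨h0, h1⟩, rfl⟩)
  have hDdisj : ∀ A B, Disjoint A B → ∀ q ∈ D A, q ∉ D B := by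
    intro A B hAB q hqA hqB
    rw [Set.disjoint_left] at hAB
    rcases hqA with ⟨a, ha, rfl⟩ | ⟨u, hu, v, hv, huv, hq⟩
    · rcases hqB with ⟨b, hb, hab⟩ | ⟨u', hu', v', hv', huv', hq'⟩
      · exact hAB ha (hinj hab ▸ hb)
      · exact hint u' v' huv' a hq'
    · rcases hqB with ⟨b, hb, rfl⟩ | ⟨u', hu', v', hv', huv', hq'⟩
      · exact hint u v huv b hq
      · refine hcross u v u' v' huv huv' ?_ q hq (Set.image_mono Set.Ioo_subset_Icc_self hq')
        intro he
        have : u ∈ s(u', v') := he ▸ Sym2.mem_mk_left u v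
        rcases Sym2.mem_iff.1 this with h | h
        · exact hAB hu (h ▸ hu')
        · exact hAB hu (h ▸ hv')
  have hedge : ∀ A : Set W, ∀ u ∈ A, ∀ v ∈ A, G.Adj u v → JoinedIn (D A) (pos u) (pos v) := by
    intro A u hu v hv h
    refine JoinedIn.ofLine (harc u v h).1 (harc u v h).2.2.1 (harc u v h).2.2.2 ?_
    rintro _ ⟨t, ht, rfl⟩
    rcases hIcc u v h t ht with e | e | e
    · exact Or.inl ⟨u, hu, e⟩
    · exact Or.inl ⟨v, hv, e⟩
    · exact Or.inr ⟨u, hu, v, hv, h, e⟩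
  have hbranch : ∀ A : Set W, ∀ i, ν i ⊆ A → ∀ a ∈ ν i, ∀ b ∈ ν i,
      JoinedIn (D A) (pos a) (pos b) := by
    intro A i hA a ha b hb
    have := hconn i a ha b hb
    clear hb
    induction this with
    | refl => exact JoinedIn.refl (Or.inl ⟨a, hA ha, rfl⟩)
    | tail _ h ih => exact ih.trans (hedge A _ (hA h.2.1) _ (hA h.2.2) h.1)
  choose r hr using hne
  have hpath : ∀ i j, i ≠ j → JoinedIn (D (ν i ∪ ν j)) (pos (r i)) (pos (r j)) := by
    intro i j hij
    obtain ⟨a, ha, b, hb, hab⟩ := hadj i j hij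
    exact ((hbranch _ i Set.subset_union_left _ (hr i) a ha).trans
      (hedge _ a (Or.inl ha) b (Or.inr hb) hab)).trans
      (hbranch _ j Set.subset_union_right b hb _ (hr j))
  have hγ : ∀ i j, ∃ g : ℝ → ℝ × ℝ, i ≠ j → Continuous g ∧ g 0 = pos (r i) ∧
      g 1 = pos (r j) ∧ ∀ t, g t ∈ D (ν i ∪ ν j) := by
    intro i j
    by_cases hij : i = j
    · exact ⟨0, fun h => absurd hij h⟩
    · obtain ⟨P, hP⟩ := hpath i j hij
      exact ⟨P.extend, fun _ => ⟨P.continuous_extend, P.extend_zero, P.extend_one,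
        fun t => hP _⟩⟩
  choose g hg using hγ
  refine vanKampen_K5 (fun i => Complex.equivRealProdCLM.symm (pos (r i)))
    (fun i j t => Complex.equivRealProdCLM.symm (g i j t)) ?_ ?_ ?_ ?_
  · intro i j hij
    exact Complex.equivRealProdCLM.symm.continuous.comp (hg i j hij).1
  · intro i j hij
    simp only [(hg i j hij).2.1]
  · intro i j hij
    simp only [(hg i j hij).2.2.1]
  · intro i j k l hij hkl hik hil hjk hjl s t he
    have he' := Complex.equivRealProdCLM.symm.injective he
    refine hDdisj (ν i ∪ ν j) (ν k ∪ ν l) ?_ _ ((hg i j hij).2.2.2 s)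
      (he' ▸ (hg k l hkl).2.2.2 t)
    simp only [Set.disjoint_union_left, Set.disjoint_union_right]
    exact ⟨⟨hdisj _ _ hik, hdisj _ _ hjk⟩, hdisj _ _ hil, hdisj _ _ hjl⟩

/-- If `G₀` has a plane embedding in which all vertices of `X` lie on the
boundary of the outer face — equivalently, the graph obtained by adding a new
apex vertex adjacent to all of `X` is still planar — then `G₀` is
`X`-rooted-`K₄`-minor-free. -/
theorem outer_face_rooted_K4_free {V : Type*} (G₀ : SimpleGraph V) (X : Set V)
    (hplanar : IsPlanar (addVertex G₀ X)) :
    ¬ HasRootedCliqueMinor G₀ X 4 := by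
  rintro ⟨μ, h1, h2, h3⟩
  have hadj : ∀ a b, G₀.Adj a b → (addVertex G₀ X).Adj (some a) (some b) := by
    intro a b h
    rw [addVertex, SimpleGraph.fromRel_adj]
    exact ⟨by simpa using h.ne, Or.inl h⟩
  have hadjX : ∀ a ∈ X, (addVertex G₀ X).Adj none (some a) := by
    intro a h
    rw [addVertex, SimpleGraph.fromRel_adj]
    exact ⟨by simp, Or.inl h⟩
  refine planar_no_K5_minor (addVertex G₀ X) hplanar
    (Fin.cons {none} (fun i => some '' μ i)) ?_ ?_ ?_ ?_
  · intro i
    refine Fin.cases ?_ (fun i => ?_) i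
    · simp
    · obtain ⟨x, hx, -⟩ := (h1 i).1
      exact ⟨some x, x, hx, rfl⟩
  · intro i
    refine Fin.cases ?_ (fun i => ?_) i
    · rintro a ha b hb
      have ha : a = none := ha
      have hb : b = none := hb
      subst ha; subst hb
      exact Relation.ReflTransGen.refl
    · rintro _ ⟨a, ha, rfl⟩ _ ⟨b, hb, rfl⟩
      obtain ⟨w⟩ := (h1 i).2.preconnected ⟨a, ha⟩ ⟨b, hb⟩
      have key : ∀ (x y : μ i), (G₀.induce (μ i)).Walk x y →
          Relation.ReflTransGen (fun u v => (addVertex G₀ X).Adj u v ∧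
            u ∈ some '' μ i ∧ v ∈ some '' μ i) (some x.1) (some y.1) := by
        intro x y w
        induction w with
        | nil => exact Relation.ReflTransGen.refl
        | @cons u v _ h _ ih =>
          exact Relation.ReflTransGen.head
            ⟨hadj _ _ h, ⟨u.1, u.2, rfl⟩, ⟨v.1, v.2, rfl⟩⟩ ih
      exact key _ _ w
  · intro i j
    refine Fin.cases ?_ (fun i => ?_) i <;> refine Fin.cases ?_ (fun j => ?_) j
    · simp
    · intro _
      simp
    · intro _
      simp
    · intro hij
      have hij' : i ≠ j := fun h => hij (by rw [h])
      simpa using (Set.disjoint_image_iff (Option.some_injective V)).2 (h2 i j hij')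
  · intro i j
    refine Fin.cases ?_ (fun i => ?_) i <;> refine Fin.cases ?_ (fun j => ?_) j
    · simp
    · intro _
      obtain ⟨x, hx, hX⟩ := (h1 j).1
      exact ⟨none, rfl, some x, ⟨x, hx, rfl⟩, hadjX x hX⟩
    · intro _
      obtain ⟨x, hx, hX⟩ := (h1 i).1
      exact ⟨some x, ⟨x, hx, rfl⟩, none, rfl, (hadjX x hX).symm⟩
    · intro hij
      have hij' : i ≠ j := fun h => hij (by rw [h])
      obtain ⟨a, ha, b, hb, hab⟩ := h3 i j hij'
      exact ⟨some a, ⟨a, ha, rfl⟩, some b, ⟨b, hb, rfl⟩, hadj _ _ hab⟩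
end
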